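/- arXiv:1505.06229 — 8 statements merged into one kernel-verified Lean document; each statement's English description precedes it below -/
import Mathlib

section
/- Let α = (3−√5)/2. For every n ≥ 2 one has |q_{n−1}| ≤ α·|q_n|. -/
/-- Lemma 3.1: with α = (3−√5)/2 and q the NICF continuant sequence of a digit
sequence ω with |ω_n| ≥ 3 for all n ≥ 1, one has |q_{n−1}| ≤ α·|q_n| for every n ≥ 2. -/
theorem nicf_ratio_le_alpha (ω q : ℕ → ℤ)
    (hω : ∀ n, 1 ≤ n → 3 ≤ |ω n|)
    (hq0 : q 0 = 1) (hq1 : q 1 = ω 1)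
    (hrec : ∀ n, 2 ≤ n → q n = ω n * q (n - 1) + q (n - 2)) :
    ∀ n, 2 ≤ n → (|q (n - 1)| : ℝ) ≤ (3 - Real.sqrt 5) / 2 * |q n| := by
  have h5 : Real.sqrt 5 ^ 2 = 5 := Real.sq_sqrt (by norm_num)
  have h5lt : Real.sqrt 5 < 7 / 3 := by
    rw [Real.sqrt_lt' (by norm_num)]; norm_num
  set α : ℝ := (3 - Real.sqrt 5) / 2 with hα
  have hα_third : 1 / 3 < α := by linarith
  have hα_eq : α * (3 - α) = 1 := by rw [hα]; linear_combination h5 / (-4)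
  have hωR : ∀ n, 1 ≤ n → (3 : ℝ) ≤ |(ω n : ℝ)| := fun n hn => by
    exact_mod_cast hω n hn
  have key : ∀ n, |(q n : ℝ)| ≤ α * |(q (n + 1) : ℝ)| := by
    intro n
    induction n with
    | zero =>
      have h := hωR 1 le_rfl
      simp only [zero_add, hq0, hq1, Int.cast_one, abs_one]
      nlinarith
    | succ k ih =>
      have hr : (q (k + 2) : ℝ) = ω (k + 2) * q (k + 1) + q k := by
        exact_mod_cast hrec (k + 2) (by omega)
      have hlower : |(ω (k + 2) : ℝ)| * |(q (k + 1) : ℝ)| - |(q k : ℝ)| ≤ |(q (k + 2) : ℝ)| := by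
        rw [hr, ← abs_mul]
        simpa using abs_sub_abs_le_abs_sub ((ω (k + 2) : ℝ) * q (k + 1)) (-(q k : ℝ))
      have hmul := mul_le_mul_of_nonneg_right (hωR (k + 2) (by omega))
        (abs_nonneg (q (k + 1) : ℝ))
      have hgrow : (3 - α) * |(q (k + 1) : ℝ)| ≤ |(q (k + 2) : ℝ)| := by linarith
      calc |(q (k + 1) : ℝ)| = α * ((3 - α) * |(q (k + 1) : ℝ)|) := by
            rw [← mul_assoc, hα_eq, one_mul]
        _ ≤ α * |(q (k + 2) : ℝ)| := mul_le_mul_of_nonneg_left hgrow (by linarith)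
  intro n hn
  obtain ⟨m, rfl⟩ := Nat.exists_eq_add_of_le' (show 1 ≤ n by omega)
  simpa using key m
end

section
/- For every n ≥ 2 one has (|ω_n| − α)·|q_{n−1}| ≤ |q_n|. -/
/-- A three-term recurrence `z = w * y + x` with `|x| ≤ a * |y|` gives a lower bound for `|z|`. -/
theorem abs_sub_mul_abs_le_abs_mul_add {a w x y : ℝ} (h : |x| ≤ a * |y|) :
    (|w| - a) * |y| ≤ |w * y + x| := by
  have h₁ : |w * y| - |x| ≤ |w * y + x| := by
    simpa using abs_sub_abs_le_abs_sub (w * y) (-x)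
  rw [abs_mul] at h₁
  linarith

/-- Consecutive continuants satisfy `|q n| ≤ (3 - √5) / 2 * |q (n + 1)|`. -/
theorem abs_continuant_le_mul_abs_succ (ω q : ℕ → ℤ)
    (hω : ∀ n, 1 ≤ n → 3 ≤ |ω n|)
    (hq0 : q 0 = 1) (hq1 : q 1 = ω 1)
    (hrec : ∀ n, 2 ≤ n → q n = ω n * q (n - 1) + q (n - 2)) (n : ℕ) :
    |(q n : ℝ)| ≤ (3 - Real.sqrt 5) / 2 * |(q (n + 1) : ℝ)| := by
  have hω' (m : ℕ) (hm : 1 ≤ m) : (3 : ℝ) ≤ |(ω m : ℝ)| := by exact_mod_cast hω m hm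
  have hsq : Real.sqrt 5 ^ 2 = 5 := Real.sq_sqrt (by norm_num)
  have hlt : Real.sqrt 5 < 7 / 3 := by
    rw [Real.sqrt_lt' (by norm_num)]
    norm_num
  induction n with
  | zero =>
    rw [zero_add, hq0, hq1, Int.cast_one, abs_one]
    nlinarith [hω' 1 le_rfl]
  | succ n ih =>
    have hstep : (q (n + 2) : ℝ) = ω (n + 2) * q (n + 1) + q n := by
      exact_mod_cast hrec (n + 2) (by omega)
    have hlow := abs_sub_mul_abs_le_abs_mul_add (w := (ω (n + 2) : ℝ)) ih
    rw [← hstep] at hlow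
    set a : ℝ := (3 - Real.sqrt 5) / 2 with ha
    have ha0 : 0 ≤ a := by linarith
    have ha1 : a * (3 - a) = 1 := by
      rw [ha]
      linear_combination -hsq / 4
    calc |(q (n + 1) : ℝ)| = a * ((3 - a) * |(q (n + 1) : ℝ)|) := by
          rw [← mul_assoc, ha1, one_mul]
      _ ≤ a * ((|(ω (n + 2) : ℝ)| - a) * |(q (n + 1) : ℝ)|) := by
          gcongr
          exact hω' (n + 2) (by omega)
      _ ≤ a * |(q (n + 2) : ℝ)| := by gcongr

/-- Corollary 3.2: with α = (3−√5)/2 and q the NICF continuant sequence of a digit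
sequence ω with |ω_n| ≥ 3 for all n ≥ 1, one has (|ω_n| − α)·|q_{n−1}| ≤ |q_n| for every n ≥ 2. -/
theorem nicf_ratio_le (ω q : ℕ → ℤ)
    (hω : ∀ n, 1 ≤ n → 3 ≤ |ω n|)
    (hq0 : q 0 = 1) (hq1 : q 1 = ω 1)
    (hrec : ∀ n, 2 ≤ n → q n = ω n * q (n - 1) + q (n - 2)) :
    ∀ n, 2 ≤ n → ((|ω n| : ℝ) - (3 - Real.sqrt 5) / 2) * |q (n - 1)| ≤ (|q n| : ℝ) := by
  intro n hn
  have h := abs_continuant_le_mul_abs_succ ω q hω hq0 hq1 hrec (n - 2)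
  rw [show n - 2 + 1 = n - 1 by omega] at h
  have hlow := abs_sub_mul_abs_le_abs_mul_add (w := (ω n : ℝ)) h
  rw [hrec n hn]
  push_cast
  exact hlow
end

section
/- For every n ≥ 2 one has |q_n| ≤ (|ω_n| + α)·|q_{n−1}|. -/
/-- Lemma 3.3: with α = (3−√5)/2 and q the NICF continuant sequence of a digit
sequence ω with |ω_n| ≥ 3 for all n ≥ 1, one has |q_n| ≤ (|ω_n| + α)·|q_{n−1}| for every n ≥ 2. -/
theorem nicf_ratio_ge (ω q : ℕ → ℤ)
    (hω : ∀ n, 1 ≤ n → 3 ≤ |ω n|)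
    (hq0 : q 0 = 1) (hq1 : q 1 = ω 1)
    (hrec : ∀ n, 2 ≤ n → q n = ω n * q (n - 1) + q (n - 2)) :
    ∀ n, 2 ≤ n → (|q n| : ℝ) ≤ ((|ω n| : ℝ) + (3 - Real.sqrt 5) / 2) * |q (n - 1)| := by
  intro n hn
  obtain ⟨k, rfl⟩ := Nat.exists_eq_add_of_le' hn
  have hstep : (q (k + 2) : ℝ) = ω (k + 2) * q (k + 1) + q k := by
    exact_mod_cast hrec (k + 2) hn
  have hprev := abs_continuant_le_mul_abs_succ ω q hω hq0 hq1 hrec k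
  rw [show k + 2 - 1 = k + 1 from rfl, hstep, Int.cast_abs, add_mul, ← abs_mul]
  exact (abs_add_le _ _).trans (by gcongr)
end

section
/- For every n ≥ 1 and every x ∈ [−1/2, 1/2] one has (2/3)·|q_{n+1} + x·q_n| ≤ (|ω_{n+1}| + α)·|q_n + x·q_{n−1}|; equivalently, the function G_ω(x) = |(q_n + x·q_{n−1})/(q_{n+1} + x·q_n)| satisfies G_ω(x) ≥ (2/3)·1/(|ω_{n+1}| + α). -/
/-- Consecutive continuants of a digit sequence with `|ω n| ≥ 3` satisfy
`|q n| ≤ (2 / 5) * |q (n + 1)|`. -/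
theorem five_mul_abs_continuant_le (ω q : ℕ → ℤ)
    (hω : ∀ n, 1 ≤ n → 3 ≤ |ω n|)
    (hq0 : q 0 = 1) (hq1 : q 1 = ω 1)
    (hrec : ∀ n, 2 ≤ n → q n = ω n * q (n - 1) + q (n - 2)) (n : ℕ) :
    5 * |q n| ≤ 2 * |q (n + 1)| := by
  induction n with
  | zero =>
    have := hω 1 le_rfl
    rw [zero_add, hq0, hq1, abs_one]
    linarith
  | succ k ih =>
    have hk : q (k + 2) = ω (k + 2) * q (k + 1) + q k := hrec (k + 2) (by omega)
    have hdigit := mul_le_mul_of_nonneg_right (hω (k + 2) (by omega)) (abs_nonneg (q (k + 1)))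
    have htri := abs_sub_abs_le_abs_add (ω (k + 2) * q (k + 1)) (q k)
    rw [abs_mul, ← hk] at htri
    have := abs_nonneg (q (k + 1))
    change 5 * |q (k + 1)| ≤ 2 * |q (k + 2)|
    linarith

/-- Lemma 3.5: with α = (3−√5)/2 and q the NICF continuant sequence of a digit sequence ω
with |ω_n| ≥ 3 for all n ≥ 1, for every n ≥ 1 and every x ∈ [−1/2, 1/2] one has
(2/3)·|q_{n+1} + x·q_n| ≤ (|ω_{n+1}| + α)·|q_n + x·q_{n−1}|, i.e.
G_ω(x) = |(q_n + x·q_{n−1})/(q_{n+1} + x·q_n)| ≥ (2/3)·1/(|ω_{n+1}| + α). -/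
theorem nicf_G_lower (ω q : ℕ → ℤ)
    (hω : ∀ n, 1 ≤ n → 3 ≤ |ω n|)
    (hq0 : q 0 = 1) (hq1 : q 1 = ω 1)
    (hrec : ∀ n, 2 ≤ n → q n = ω n * q (n - 1) + q (n - 2)) :
    ∀ n, 1 ≤ n → ∀ x ∈ Set.Icc (-(1 : ℝ) / 2) (1 / 2),
      (2 / 3) * |(q (n + 1) : ℝ) + x * q n|
        ≤ ((|ω (n + 1)| : ℝ) + (3 - Real.sqrt 5) / 2) * |(q n : ℝ) + x * q (n - 1)| := by
  intro n hn x hx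
  obtain ⟨m, rfl⟩ : ∃ m, n = m + 1 := ⟨n - 1, by omega⟩
  have hratio : 5 * |(q m : ℝ)| ≤ 2 * |(q (m + 1) : ℝ)| := by
    exact_mod_cast five_mul_abs_continuant_le ω q hω hq0 hq1 hrec m
  have hdigit : (3 : ℝ) ≤ |(ω (m + 2) : ℝ)| := by
    exact_mod_cast hω (m + 2) (by omega)
  have hnext : (q (m + 2) : ℝ) = ω (m + 2) * q (m + 1) + q m := by
    exact_mod_cast hrec (m + 2) (by omega)
  have hxabs : |x| ≤ 1 / 2 := abs_le.mpr ⟨by linarith [hx.1], hx.2⟩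
  have hsqrt : √5 ≤ 2.24 := Real.sqrt_le_iff.mpr ⟨by norm_num, by norm_num⟩
  have hA := abs_nonneg (q (m + 1) : ℝ)
  have hupper : |(q (m + 2) : ℝ) + x * q (m + 1)|
      ≤ (|(ω (m + 2) : ℝ)| + 9 / 10) * |(q (m + 1) : ℝ)| := by
    have htri := abs_add_three (ω (m + 2) * q (m + 1) : ℝ) (q m) (x * q (m + 1))
    rw [abs_mul, abs_mul, ← hnext] at htri
    have := mul_le_mul_of_nonneg_right hxabs hA
    linarith
  have hlower : 4 / 5 * |(q (m + 1) : ℝ)| ≤ |(q (m + 1) : ℝ) + x * q m| := by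
    have htri := abs_sub_abs_le_abs_add (q (m + 1) : ℝ) (x * q m)
    rw [abs_mul] at htri
    have := mul_le_mul_of_nonneg_right hxabs (abs_nonneg (q m : ℝ))
    linarith
  change 2 / 3 * |(q (m + 2) : ℝ) + x * q (m + 1)|
    ≤ (|(ω (m + 2) : ℝ)| + (3 - √5) / 2) * |(q (m + 1) : ℝ) + x * q m|
  calc 2 / 3 * |(q (m + 2) : ℝ) + x * q (m + 1)|
      ≤ 2 / 3 * ((|(ω (m + 2) : ℝ)| + 9 / 10) * |(q (m + 1) : ℝ)|) := by gcongr
    _ = 2 / 3 * (|(ω (m + 2) : ℝ)| + 9 / 10) * |(q (m + 1) : ℝ)| := by ring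
    _ ≤ (|(ω (m + 2) : ℝ)| + (3 - √5) / 2) * (4 / 5) * |(q (m + 1) : ℝ)| := by
      gcongr ?_ * _
      linarith
    _ = (|(ω (m + 2) : ℝ)| + (3 - √5) / 2) * (4 / 5 * |(q (m + 1) : ℝ)|) := by ring
    _ ≤ (|(ω (m + 2) : ℝ)| + (3 - √5) / 2) * |(q (m + 1) : ℝ) + x * q m| :=
      mul_le_mul_of_nonneg_left hlower (by linarith)
end

section
/- For every integer k ≥ 4 one has (9/4)·1/(k − α)² ≤ (8/9)·Σ_{j=k+1}^∞ 1/(j + α)², where the sum runs over all integers j ≥ k+1. -/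
theorem summable_one_div_add_nat_sq {x : ℝ} (hx : 1 ≤ x) :
    Summable fun j : ℕ => 1 / (x + j) ^ 2 := by
  have h : Summable fun j : ℕ => 1 / ((j + 1 : ℕ) : ℝ) ^ 2 :=
    (summable_nat_add_iff 1).mpr (Real.summable_one_div_nat_pow.mpr one_lt_two)
  refine h.of_nonneg_of_le (fun j => by positivity) fun j => ?_
  have hj : (0 : ℝ) ≤ j := j.cast_nonneg
  push_cast
  exact one_div_le_one_div_of_le (by positivity)
    (pow_le_pow_left₀ (by positivity) (by linarith) 2)

theorem one_div_sub_one_div_le_one_div_sq {y : ℝ} (hy : 1 ≤ y) :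
    1 / (y - 3 / 8) - 1 / (y + 5 / 8) ≤ 1 / y ^ 2 := by
  have h₁ : 0 < y - 3 / 8 := by linarith
  have h₂ : 0 < y + 5 / 8 := by linarith
  rw [div_sub_div _ _ h₁.ne' h₂.ne', div_le_div_iff₀ (by positivity) (by positivity)]
  nlinarith

/-- A midpoint-type lower bound for the tail of `∑ 1 / j ^ 2`, obtained by telescoping. -/
theorem one_div_le_tsum_one_div_add_nat_sq {x : ℝ} (hx : 1 ≤ x) :
    1 / (x - 3 / 8) ≤ ∑' j : ℕ, 1 / (x + j) ^ 2 := by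
  have partial_sum (n : ℕ) :
      1 / (x - 3 / 8) - 1 / (x - 3 / 8 + n) ≤ ∑' j : ℕ, 1 / (x + j) ^ 2 := by
    refine le_trans ?_ ((summable_one_div_add_nat_sq hx).sum_le_tsum (Finset.range n)
      fun j _ => by positivity)
    induction n with
    | zero => simp
    | succ n ih =>
      have hn : (0 : ℝ) ≤ n := n.cast_nonneg
      have h := one_div_sub_one_div_le_one_div_sq (y := x + n) (by linarith)
      rw [show x + n - 3 / 8 = x - 3 / 8 + n by ring,
        show x + n + 5 / 8 = x - 3 / 8 + (n + 1) by ring] at h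
      rw [Finset.sum_range_succ]
      push_cast
      linarith
  have lim : Filter.Tendsto (fun n : ℕ => 1 / (x - 3 / 8) - 1 / (x - 3 / 8 + n))
      Filter.atTop (nhds (1 / (x - 3 / 8) - 0)) :=
    tendsto_const_nhds.sub (tendsto_const_nhds.div_atTop
      (Filter.tendsto_atTop_add_const_left _ _ tendsto_natCast_atTop_atTop))
  rw [sub_zero] at lim
  exact le_of_tendsto' lim partial_sum

/-- Lemma 4.6: with α = (3−√5)/2, for every integer k ≥ 4,
(9/4)·1/(k − α)² ≤ (8/9)·Σ_{j ≥ k+1} 1/(j + α)². -/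
theorem nicf_tail_sum (k : ℕ) (hk : 4 ≤ k) :
    (9 / 4) * (1 / ((k : ℝ) - (3 - Real.sqrt 5) / 2) ^ 2)
      ≤ (8 / 9) * ∑' j : ℕ, 1 / (((k : ℝ) + 1 + j) + (3 - Real.sqrt 5) / 2) ^ 2 := by
  have hk' : (4 : ℝ) ≤ k := by exact_mod_cast hk
  have hα₀ : 0 ≤ (3 - Real.sqrt 5) / 2 := by
    have : Real.sqrt 5 ≤ 3 := Real.sqrt_le_iff.mpr (by norm_num)
    linarith
  have hα₁ : (3 - Real.sqrt 5) / 2 ≤ 0.385 := by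
    have : 2.23 ≤ Real.sqrt 5 := Real.le_sqrt_of_sq_le (by norm_num)
    linarith
  generalize (3 - Real.sqrt 5) / 2 = α at *
  have tail := one_div_le_tsum_one_div_add_nat_sq (x := k + 1 + α) (by linarith)
  simp only [add_right_comm _ α] at tail
  refine le_trans ?_ (mul_le_mul_of_nonneg_left tail (by norm_num))
  have h₁ : 0 < (k : ℝ) - α := by linarith
  have h₂ : 0 < (k : ℝ) + α + 1 - 3 / 8 := by linarith
  rw [mul_one_div, mul_one_div, div_le_div_iff₀ (by positivity) (by linarith)]
  nlinarith [mul_nonneg (sub_nonneg.mpr hk') (sub_nonneg.mpr hα₁)]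
end

section
/- For all finite sequences ω = (ω_1, …, ω_p) and ω̄ = (ω̄_1, …, ω̄_q) of elements of F, every b ∈ F, and every x ∈ [−1/2, 1/2], the derivatives of the composed maps satisfy |(φ_{ω_1}∘⋯∘φ_{ω_p}∘φ_b∘φ_{ω̄_1}∘⋯∘φ_{ω̄_q})′(x)| ≤ ((3/2)·1/(|b| − α))²·|(φ_{ω_1}∘⋯∘φ_{ω_p}∘φ_{ω̄_1}∘⋯∘φ_{ω̄_q})′(x)| and |(φ_{ω_1}∘⋯∘φ_{ω_p}∘φ_b∘φ_{ω̄_1}∘⋯∘φ_{ω̄_q})′(x)| ≥ ((2/3)·1/(|b| + α))²·|(φ_{ω_1}∘⋯∘φ_{ω_p}∘φ_{ω̄_1}∘⋯∘φ_{ω̄_q})′(x)|, where α = (3−√5)/2. -/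
/-- The inverse branch φ_b(x) = 1/(b+x) of the nearest integer continued fraction map. -/
noncomputable def nicfPhi (b : ℤ) : ℝ → ℝ := fun x => 1 / ((b : ℝ) + x)

/-- Composition φ_{w_1} ∘ ⋯ ∘ φ_{w_m} coded by a finite word w. -/
noncomputable def nicfComp (w : List ℤ) : ℝ → ℝ :=
  w.foldr (fun b f => nicfPhi b ∘ f) id

/-- The quantity `(3 - √5) / 2`, the smaller root of `α ^ 2 - 3 α + 1`. -/
noncomputable def nicfAlpha : ℝ := (3 - Real.sqrt 5) / 2

theorem nicfAlpha_sq : nicfAlpha ^ 2 = 3 * nicfAlpha - 1 := by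
  have h : Real.sqrt 5 ^ 2 = 5 := Real.sq_sqrt (by norm_num)
  unfold nicfAlpha
  linarith

theorem nicfAlpha_pos : 0 < nicfAlpha := by
  have h : Real.sqrt 5 < 3 := (Real.sqrt_lt' (by norm_num)).2 (by norm_num)
  unfold nicfAlpha
  linarith

theorem nicfAlpha_lt : nicfAlpha < 2 / 5 := by
  have h : (11 / 5 : ℝ) < Real.sqrt 5 := Real.lt_sqrt_of_sq_lt (by norm_num)
  unfold nicfAlpha
  linarith

theorem nicfComp_append (u v : List ℤ) : nicfComp (u ++ v) = nicfComp u ∘ nicfComp v := by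
  induction u with
  | nil => rfl
  | cons a u ih =>
    change nicfPhi a ∘ nicfComp (u ++ v) = (nicfPhi a ∘ nicfComp u) ∘ nicfComp v
    rw [ih, Function.comp_assoc]

theorem three_sub_abs_le_abs_add {a : ℤ} (ha : 3 ≤ |a|) (x : ℝ) : 3 - |x| ≤ |(a : ℝ) + x| := by
  have h : (3 : ℝ) ≤ |(a : ℝ)| := by exact_mod_cast ha
  have h' := abs_sub_abs_le_abs_sub (a : ℝ) (-x)
  rw [abs_neg, sub_neg_eq_add] at h'
  linarith

theorem intCast_add_ne_zero {a : ℤ} (ha : 3 ≤ |a|) {x : ℝ} (hx : |x| ≤ 1 / 2) :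
    (a : ℝ) + x ≠ 0 := by
  have h := three_sub_abs_le_abs_add ha x
  exact abs_pos.1 (by linarith)

theorem abs_nicfPhi_le {a : ℤ} (ha : 3 ≤ |a|) {x : ℝ} (hx : |x| ≤ 1 / 2) :
    |nicfPhi a x| ≤ 1 / 2 := by
  have h := three_sub_abs_le_abs_add ha x
  rw [nicfPhi, abs_div, abs_one]
  exact one_div_le_one_div_of_le (by norm_num) (by linarith)

theorem abs_nicfComp_le {w : List ℤ} (hw : ∀ a ∈ w, 3 ≤ |a|) {x : ℝ} (hx : |x| ≤ 1 / 2) :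
    |nicfComp w x| ≤ 1 / 2 := by
  induction w with
  | nil => exact hx
  | cons a w ih =>
    exact abs_nicfPhi_le (hw a List.mem_cons_self) (ih fun c hc => hw c (List.mem_cons_of_mem _ hc))

theorem hasDerivAt_nicfPhi {a : ℤ} {x : ℝ} (h : (a : ℝ) + x ≠ 0) :
    HasDerivAt (nicfPhi a) (-1 / ((a : ℝ) + x) ^ 2) x := by
  have h' := ((hasDerivAt_id x).const_add (a : ℝ)).inv h
  have e : nicfPhi a = fun t => ((a : ℝ) + t)⁻¹ := funext fun t => one_div _
  rw [e]
  exact h'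

theorem four_fifths_lt_one_add_mul {r y : ℝ} (hr : |r| ≤ nicfAlpha) (hy : |y| ≤ 1 / 2) :
    4 / 5 < 1 + r * y := by
  have h : |r * y| < 1 / 5 := by
    rw [abs_mul]
    nlinarith [nicfAlpha_lt, abs_nonneg r, abs_nonneg y]
  linarith [(abs_lt.1 h).1]

/-- The derivative of `φ_w` has the form `c / (1 + r x) ^ 2`, where `r` is the ratio of the last
two denominators of the continued fraction, and `|r| ≤ α`. -/
theorem exists_hasDerivAt_nicfComp {w : List ℤ} (hw : ∀ a ∈ w, 3 ≤ |a|) :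
    ∃ c r : ℝ, |r| ≤ nicfAlpha ∧
      ∀ x : ℝ, |x| ≤ 1 / 2 → HasDerivAt (nicfComp w) (c / (1 + r * x) ^ 2) x := by
  induction w using List.reverseRecOn with
  | nil =>
    refine ⟨1, 0, by simpa using nicfAlpha_pos.le, fun x _ => ?_⟩
    rw [zero_mul, add_zero, one_pow, div_one]
    exact hasDerivAt_id x
  | append_singleton w a ih =>
    obtain ⟨c, r, hr, hd⟩ := ih fun e he => hw e (List.mem_append_left _ he)
    have ha : 3 ≤ |a| := hw a (by simp)
    have hα := nicfAlpha_lt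
    have hr' : |r| ≤ 1 / 2 := by linarith
    have har := intCast_add_ne_zero ha hr'
    refine ⟨-c / (a + r) ^ 2, 1 / (a + r), ?_, fun x hx => ?_⟩
    · have h := three_sub_abs_le_abs_add ha r
      rw [abs_div, abs_one, div_le_iff₀ (abs_pos.2 har)]
      nlinarith [nicfAlpha_sq, nicfAlpha_pos]
    · have hax := intCast_add_ne_zero ha hx
      have hz := abs_nicfPhi_le ha hx
      have hpos := four_fifths_lt_one_add_mul hr hz
      rw [nicfComp_append]
      refine ((hd _ hz).comp x (hasDerivAt_nicfPhi hax)).congr_deriv ?_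
      have e₁ : 1 + r * nicfPhi a x = (a + x + r) / (a + x) := by
        rw [nicfPhi]
        field_simp
      have e₂ : 1 + 1 / (a + r) * x = (a + x + r) / (a + r) := by
        field_simp
        ring
      have hn : (a : ℝ) + x + r ≠ 0 := by
        intro h0
        rw [e₁, h0, zero_div] at hpos
        linarith
      rw [e₁, e₂]
      field_simp

theorem insert_ratio_bounds_of_pos {b r y : ℝ} (hb : 3 ≤ b) (hr : |r| ≤ nicfAlpha)
    (hy : |y| ≤ 1 / 2) :
    (1 + r * y) * (b - nicfAlpha) ≤ 3 / 2 * (b + y + r) ∧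
      2 / 3 * (b + y + r) ≤ (1 + r * y) * (b + nicfAlpha) := by
  have hα := nicfAlpha_lt
  have hα₀ := nicfAlpha_pos
  have hα₂ := nicfAlpha_sq
  have hpos := four_fifths_lt_one_add_mul hr hy
  have hneg := four_fifths_lt_one_add_mul (r := -r) (by rwa [abs_neg]) hy
  obtain ⟨hr₁, hr₂⟩ := abs_le.1 hr
  obtain ⟨hy₁, hy₂⟩ := abs_le.1 hy
  constructor
  · have h3 : (1 + r * y) * (3 - nicfAlpha) ≤ 3 / 2 * (3 + y + r) := by
      have hs : r * y * (3 - nicfAlpha) ≤ 3 / 2 * (y + r) + 3 / 2 + nicfAlpha := by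
        nlinarith [mul_nonneg (by linarith : 0 ≤ nicfAlpha + r) (by linarith : 0 ≤ y + 1 / 2),
          mul_nonneg (by linarith : 0 ≤ nicfAlpha - r) (by linarith : 0 ≤ y + 1 / 2),
          mul_nonneg (by linarith : 0 ≤ nicfAlpha + r) (by linarith : 0 ≤ 1 / 2 - y),
          mul_nonneg (by linarith : 0 ≤ nicfAlpha - r) (by linarith : 0 ≤ 1 / 2 - y)]
      linarith
    nlinarith
  · nlinarith

theorem insert_ratio_bounds {b r y : ℝ} (hb : 3 ≤ |b|) (hr : |r| ≤ nicfAlpha)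
    (hy : |y| ≤ 1 / 2) :
    (1 + r * y) * (|b| - nicfAlpha) ≤ 3 / 2 * |b + y + r| ∧
      2 / 3 * |b + y + r| ≤ (1 + r * y) * (|b| + nicfAlpha) := by
  have hα := nicfAlpha_lt
  obtain ⟨hr₁, hr₂⟩ := abs_le.1 hr
  obtain ⟨hy₁, hy₂⟩ := abs_le.1 hy
  rcases le_abs.1 hb with h | h
  · rw [abs_of_nonneg (by linarith : 0 ≤ b), abs_of_nonneg (by linarith : 0 ≤ b + y + r)]
    exact insert_ratio_bounds_of_pos h hr hy
  · rw [abs_of_nonpos (by linarith : b ≤ 0), abs_of_nonpos (by linarith : b + y + r ≤ 0)]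
    have := insert_ratio_bounds_of_pos h (r := -r) (y := -y) (by rwa [abs_neg]) (by rwa [abs_neg])
    rw [neg_mul_neg] at this
    rwa [neg_add, neg_add]

/-- Remark 4.5: for words ω, ω̄ over F = {b : |b| ≥ 3}, a letter b ∈ F and
x ∈ [−1/2, 1/2], with α = (3−√5)/2,
|φ'_{ω b ω̄}(x)| ≤ ((3/2)·1/(|b|−α))²·|φ'_{ω ω̄}(x)| and
|φ'_{ω b ω̄}(x)| ≥ ((2/3)·1/(|b|+α))²·|φ'_{ω ω̄}(x)|. -/
theorem nicf_insert_letter_deriv_bounds (ω ω' : List ℤ)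
    (hω : ∀ a ∈ ω, 3 ≤ |a|) (hω' : ∀ a ∈ ω', 3 ≤ |a|)
    (b : ℤ) (hb : 3 ≤ |b|) (x : ℝ) (hx : x ∈ Set.Icc (-(1 : ℝ) / 2) (1 / 2)) :
    |deriv (nicfComp (ω ++ b :: ω')) x|
        ≤ ((3 / 2) * (1 / ((|b| : ℝ) - (3 - Real.sqrt 5) / 2))) ^ 2
          * |deriv (nicfComp (ω ++ ω')) x| ∧
    ((2 / 3) * (1 / ((|b| : ℝ) + (3 - Real.sqrt 5) / 2))) ^ 2
          * |deriv (nicfComp (ω ++ ω')) x|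
        ≤ |deriv (nicfComp (ω ++ b :: ω')) x| := by
  have hx' : |x| ≤ 1 / 2 := abs_le.2 ⟨by linarith [hx.1], hx.2⟩
  have hb' : (3 : ℝ) ≤ |(b : ℝ)| := by exact_mod_cast hb
  have hα := nicfAlpha_lt
  have hα₀ := nicfAlpha_pos
  obtain ⟨c, r, hr, hd⟩ := exists_hasDerivAt_nicfComp hω
  obtain ⟨d, s, -, hd'⟩ := exists_hasDerivAt_nicfComp hω'
  have hy := abs_nicfComp_le hω' hx'
  have hv := hd' x hx'
  set y := nicfComp ω' x
  set D := d / (1 + s * x) ^ 2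
  have hby := intCast_add_ne_zero hb hy
  have hz := abs_nicfPhi_le hb hy
  have hpos := four_fifths_lt_one_add_mul hr hy
  have hpos' := four_fifths_lt_one_add_mul hr hz
  have e₁ : 1 + r * nicfPhi b y = (b + y + r) / (b + y) := by
    rw [nicfPhi]
    field_simp
  have hn : (b : ℝ) + y + r ≠ 0 := by
    intro h0
    rw [e₁, h0, zero_div] at hpos'
    linarith
  have hshort : deriv (nicfComp (ω ++ ω')) x = c / (1 + r * y) ^ 2 * D := by
    rw [nicfComp_append]
    exact ((hd y hy).comp x hv).deriv
  have hlong : deriv (nicfComp (ω ++ b :: ω')) x =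
      c / (1 + r * nicfPhi b y) ^ 2 * (-1 / ((b : ℝ) + y) ^ 2 * D) := by
    rw [nicfComp_append]
    exact ((hd _ hz).comp x ((hasDerivAt_nicfPhi hby).comp x hv)).deriv
  have hratio : |deriv (nicfComp (ω ++ b :: ω')) x| =
      ((1 + r * y) / |b + y + r|) ^ 2 * |deriv (nicfComp (ω ++ ω')) x| := by
    have h : deriv (nicfComp (ω ++ b :: ω')) x =
        -(((1 + r * y) / (b + y + r)) ^ 2 * deriv (nicfComp (ω ++ ω')) x) := by
      have hne : 1 + r * y ≠ 0 := by linarith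
      rw [hlong, hshort, e₁]
      generalize 1 + r * y = t at hne
      field_simp
    rw [h, abs_neg, abs_mul, abs_pow, abs_div, abs_of_pos (by linarith : 0 < 1 + r * y)]
  obtain ⟨hu, hl⟩ := insert_ratio_bounds hb' hr hy
  have hn' := abs_pos.2 hn
  change _ ≤ (3 / 2 * (1 / (|(b : ℝ)| - nicfAlpha))) ^ 2 * _ ∧
    (2 / 3 * (1 / (|(b : ℝ)| + nicfAlpha))) ^ 2 * _ ≤ _
  rw [hratio, mul_one_div, mul_one_div]
  have hpos'' : 0 < 1 + r * y := by linarith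
  have hminus : 0 < |(b : ℝ)| - nicfAlpha := by linarith
  have hplus : 0 < |(b : ℝ)| + nicfAlpha := by linarith
  constructor
  · gcongr ?_ ^ 2 * _
    rwa [div_le_div_iff₀ hn' hminus]
  · gcongr ?_ ^ 2 * _
    rwa [div_le_div_iff₀ hplus hn']
end

section
/- The iterated function system Φ^(v) associated to the nearest integer continued fraction via the vertex v has full Hausdorff dimension spectrum: {dim_H(J_G) : G ⊆ Ē^(v)} = [0, dim_H(J_{Ē^(v)})], i.e. for every real t with 0 ≤ t ≤ dim_H(J_{Ē^(v)}) there exists a subset G ⊆ Ē^(v) such that dim_H(J_G) = t. -/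
open scoped ENNReal

/-- The alphabet Ē^(v) of the IFS associated to the NICF graph directed system via the
vertex v: single letters b with |b| ≥ 3, words 2^j b with j ≥ 1 and b ≥ 3, and words
(−2)^j b with j ≥ 1 and b ≤ −3. -/
def nicfEv : Set (List ℤ) :=
  {w | (∃ b : ℤ, 3 ≤ |b| ∧ w = [b]) ∨
       (∃ j : ℕ, 1 ≤ j ∧ ∃ b : ℤ, 3 ≤ b ∧ w = List.replicate j 2 ++ [b]) ∨
       (∃ j : ℕ, 1 ≤ j ∧ ∃ b : ℤ, b ≤ -3 ∧ w = List.replicate j (-2) ++ [b])}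

/-- The limit set J_G of the system {φ_w}_{w ∈ G}, G a set of finite words: all limits
lim_n φ_{w^(1)}∘φ_{w^(2)}∘⋯∘φ_{w^(n)}(0) over sequences of words all belonging to G. -/
noncomputable def nicfLimitSetW (G : Set (List ℤ)) : Set ℝ :=
  {x | ∃ τ : ℕ → List ℤ, (∀ n, τ n ∈ G) ∧
    Filter.Tendsto (fun n => nicfComp (((List.range n).map τ).flatten) 0)
      Filter.atTop (nhds x)}

open Filter Topology
open scoped NNReal

namespace NICF

/-- The pair `(q, p)` for which `φ_u` has denominator `q + p * x`. -/
noncomputable def qp (u : List ℤ) : ℝ × ℝ :=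
  u.foldl (fun s b => ((b : ℝ) * s.1 + s.2, s.1)) (1, 0)

/-- The denominator of the Möbius map `φ_u`. -/
noncomputable def den (u : List ℤ) (x : ℝ) : ℝ := (qp u).1 + (qp u).2 * x

/-- All digits have absolute value at least two. -/
def Adm (u : List ℤ) : Prop := ∀ b ∈ u, 2 ≤ |b|

lemma qp_nil : qp [] = (1, 0) := rfl

lemma qp_concat (u : List ℤ) (b : ℤ) :
    qp (u ++ [b]) = ((b : ℝ) * (qp u).1 + (qp u).2, (qp u).1) := by
  simp [qp]

lemma comp_nil (x : ℝ) : nicfComp [] x = x := rfl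

lemma comp_cons (b : ℤ) (u : List ℤ) (x : ℝ) :
    nicfComp (b :: u) x = 1 / ((b : ℝ) + nicfComp u x) := rfl

lemma comp_append (u v : List ℤ) (x : ℝ) :
    nicfComp (u ++ v) x = nicfComp u (nicfComp v x) := by
  induction u with
  | nil => rfl
  | cons b u ih => rw [List.cons_append, comp_cons, comp_cons, ih]

lemma comp_singleton (b : ℤ) (x : ℝ) : nicfComp [b] x = 1 / ((b : ℝ) + x) := rfl

lemma two_le_abs_cast {b : ℤ} (hb : 2 ≤ |b|) : (2 : ℝ) ≤ |(b : ℝ)| := by exact_mod_cast hb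

lemma Adm.left {u v : List ℤ} (h : Adm (u ++ v)) : Adm u := fun b hb => h b (by simp [hb])

lemma Adm.right {u v : List ℤ} (h : Adm (u ++ v)) : Adm v := fun b hb => h b (by simp [hb])

lemma Adm.append {u v : List ℤ} (hu : Adm u) (hv : Adm v) : Adm (u ++ v) := by
  intro b hb
  rcases List.mem_append.1 hb with h | h
  exacts [hu b h, hv b h]

lemma Adm.abs_last {u : List ℤ} {b : ℤ} (h : Adm (u ++ [b])) : (2 : ℝ) ≤ |(b : ℝ)| :=
  two_le_abs_cast (h b (by simp))

lemma abs_mul_sub_le (b q p : ℝ) : |b| * |q| - |p| ≤ |b * q + p| := by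
  have := abs_sub_abs_le_abs_sub (b * q) (-p)
  rwa [abs_mul, abs_neg, sub_neg_eq_add] at this

lemma Adm.abs_snd_lt {u : List ℤ} (h : Adm u) : |(qp u).2| + 1 ≤ |(qp u).1| := by
  induction u using List.reverseRecOn with
  | nil => simp [qp_nil]
  | append_singleton u b ih =>
    have ih := ih h.left
    rw [qp_concat]
    have := abs_mul_sub_le (b : ℝ) (qp u).1 (qp u).2
    have hb := h.abs_last
    have := mul_le_mul_of_nonneg_right hb (abs_nonneg (qp u).1)
    simp only
    linarith

lemma Adm.one_le_abs_fst {u : List ℤ} (h : Adm u) : 1 ≤ |(qp u).1| := by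
  have := h.abs_snd_lt
  have := abs_nonneg (qp u).2
  linarith

lemma Adm.length_lt_abs_fst {u : List ℤ} (h : Adm u) : (u.length : ℝ) + 1 ≤ |(qp u).1| := by
  induction u using List.reverseRecOn with
  | nil => simp [qp_nil]
  | append_singleton u b ih =>
    have ih := ih h.left
    have h1 := h.abs_snd_lt
    rw [qp_concat] at h1 ⊢
    simp only [List.length_append, List.length_singleton, Nat.cast_add, Nat.cast_one] at *
    linarith

lemma abs_mul_le_of_abs_le {p x c : ℝ} (hx : |x| ≤ c) : |p * x| ≤ |p| * c := by
  rw [abs_mul]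
  exact mul_le_mul_of_nonneg_left hx (abs_nonneg _)

lemma Adm.le_abs_den {u : List ℤ} (h : Adm u) {x : ℝ} (hx : |x| ≤ 1 / 2) :
    |(qp u).1| / 2 ≤ |den u x| := by
  have h1 := h.abs_snd_lt
  have h2 := abs_mul_le_of_abs_le (p := (qp u).2) hx
  have h3 := abs_sub_abs_le_abs_sub (qp u).1 (-((qp u).2 * x))
  rw [abs_neg, sub_neg_eq_add] at h3
  unfold den
  linarith

lemma Adm.abs_den_le {u : List ℤ} (h : Adm u) {x : ℝ} (hx : |x| ≤ 1 / 2) :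
    |den u x| ≤ 3 / 2 * |(qp u).1| := by
  have h1 := h.abs_snd_lt
  have h2 := abs_mul_le_of_abs_le (p := (qp u).2) hx
  have h3 := abs_add_le (qp u).1 ((qp u).2 * x)
  unfold den
  linarith

lemma one_le_abs_add {b : ℤ} (hb : (2 : ℝ) ≤ |(b : ℝ)|) {x : ℝ} (hx : |x| ≤ 1) :
    1 ≤ |(b : ℝ) + x| := by
  have := abs_mul_sub_le (b : ℝ) 1 x
  simp only [abs_one, mul_one] at this
  linarith

lemma abs_one_div_le_one {y : ℝ} (hy : 1 ≤ |y|) : |1 / y| ≤ 1 := by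
  rw [abs_div, abs_one]
  exact div_le_one_of_le₀ hy (abs_nonneg _)

lemma den_concat (u : List ℤ) {b : ℤ} {x : ℝ} (hb : (b : ℝ) + x ≠ 0) :
    den (u ++ [b]) x = den u (1 / ((b : ℝ) + x)) * ((b : ℝ) + x) := by
  unfold den
  rw [qp_concat]
  field_simp
  ring

lemma ne_zero_of_one_le_abs {y : ℝ} (hy : 1 ≤ |y|) : y ≠ 0 := by
  rintro rfl
  norm_num at hy

lemma den_append (u : List ℤ) {v : List ℤ} (h : Adm v) {x : ℝ} (hx : |x| ≤ 1) :
    den (u ++ v) x = den u (nicfComp v x) * den v x := by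
  induction v using List.reverseRecOn generalizing x with
  | nil => simp [comp_nil, den, qp_nil]
  | append_singleton v b ih =>
    have h1 := one_le_abs_add h.abs_last hx
    have h0 := ne_zero_of_one_le_abs h1
    rw [← List.append_assoc, den_concat _ h0, den_concat _ h0, ih h.left (abs_one_div_le_one h1),
      comp_append, comp_singleton, mul_assoc]

lemma Adm.abs_comp_sub {u : List ℤ} (h : Adm u) {x y : ℝ} (hx : |x| ≤ 1) (hy : |y| ≤ 1) :
    |nicfComp u x - nicfComp u y| * (|den u x| * |den u y|) = |x - y| := by
  induction u using List.reverseRecOn generalizing x y with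
  | nil => simp [comp_nil, den, qp_nil]
  | append_singleton u b ih =>
    have h1 := one_le_abs_add h.abs_last hx
    have h2 := one_le_abs_add h.abs_last hy
    have h3 := ne_zero_of_one_le_abs h1
    have h4 := ne_zero_of_one_le_abs h2
    have ih := ih h.left (abs_one_div_le_one h1) (abs_one_div_le_one h2)
    rw [comp_append, comp_append, comp_singleton, comp_singleton, den_concat _ h3,
      den_concat _ h4, abs_mul, abs_mul]
    have h5 : x - y = -((1 / ((b : ℝ) + x) - 1 / ((b : ℝ) + y)) *
        (((b : ℝ) + x) * ((b : ℝ) + y))) := by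
      field_simp
      ring
    rw [h5, abs_neg, abs_mul, abs_mul, ← ih]
    ring

lemma den_zero (u : List ℤ) : den u 0 = (qp u).1 := by simp [den]

/-! ### The letters of the alphabet, enumerated by natural numbers -/

/-- The sign of the `i`-th letter. -/
def sgn (i : ℕ) : ℤ := if i % 2 = 0 then 1 else -1

/-- The number of initial digits `±2` of the `i`-th letter. -/
def twos (i : ℕ) : ℕ := (Nat.unpair (i / 2)).1

/-- The last digit of the `i`-th letter is `±(excess i + 3)`. -/
def excess (i : ℕ) : ℕ := (Nat.unpair (i / 2)).2

/-- The word with sign `ε`, with `j` initial digits `±2`, and with last digit `±(m + 3)`. -/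
def mkWord (ε : ℤ) (j m : ℕ) : List ℤ := List.replicate j (2 * ε) ++ [ε * ((m : ℤ) + 3)]

/-- The `i`-th letter of the alphabet. -/
def letter (i : ℕ) : List ℤ := mkWord (sgn i) (twos i) (excess i)

/-- The letter with the last digit of the `i`-th letter moved away from zero by `r`. -/
def shiftLetter (i r : ℕ) : ℕ := 2 * Nat.pair (twos i) (excess i + r) + i % 2

/-- The digits of a finite sequence of letters. -/
def digits (l : List ℕ) : List ℤ := (l.map letter).flatten

lemma sgn_cases (i : ℕ) : sgn i = 1 ∨ sgn i = -1 := by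
  unfold sgn; split_ifs <;> simp

lemma letter_shiftLetter (i r : ℕ) :
    letter (shiftLetter i r) = mkWord (sgn i) (twos i) (excess i + r) := by
  have h1 : (2 * Nat.pair (twos i) (excess i + r) + i % 2) / 2 =
      Nat.pair (twos i) (excess i + r) := by
    omega
  have h2 : (2 * Nat.pair (twos i) (excess i + r) + i % 2) % 2 = i % 2 := by omega
  simp only [letter, shiftLetter, sgn, twos, excess] at *
  simp only [h1, h2, Nat.unpair_pair]

lemma shiftLetter_zero (i : ℕ) : shiftLetter i 0 = i := by
  simp only [shiftLetter, twos, excess, add_zero, Nat.pair_unpair]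
  omega

lemma shiftLetter_strictMono (i : ℕ) : StrictMono (shiftLetter i) := by
  intro r r' h
  have := Nat.pair_lt_pair_right (twos i) (show excess i + r < excess i + r' by omega)
  unfold shiftLetter
  omega

lemma exists_letter_eq_mkWord {ε : ℤ} (hε : ε = 1 ∨ ε = -1) (j m : ℕ) :
    ∃ i, letter i = mkWord ε j m := by
  rcases hε with rfl | rfl
  · refine ⟨2 * Nat.pair j m, ?_⟩
    have h1 : (2 * Nat.pair j m) / 2 = Nat.pair j m := by omega
    simp [letter, sgn, twos, excess]
  · refine ⟨2 * Nat.pair j m + 1, ?_⟩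
    have h1 : (2 * Nat.pair j m + 1) / 2 = Nat.pair j m := by omega
    have h2 : ¬ (2 * Nat.pair j m + 1) % 2 = 0 := by omega
    simp only [letter, sgn, twos, excess, h1, h2, Nat.unpair_pair, if_false]

lemma eq_of_sgn_twos_excess {i i' : ℕ} (h1 : sgn i = sgn i') (h2 : twos i = twos i')
    (h3 : excess i = excess i') : i = i' := by
  have h4 : i / 2 = i' / 2 := by
    rw [← Nat.pair_unpair (i / 2), ← Nat.pair_unpair (i' / 2)]
    exact congrArg₂ Nat.pair h2 h3
  have h5 : i % 2 = i' % 2 := by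
    unfold sgn at h1
    split_ifs at h1 <;> omega
  omega

lemma range_letter : Set.range letter = nicfEv := by
  ext w
  constructor
  · rintro ⟨i, rfl⟩
    rcases Nat.eq_zero_or_pos (twos i) with h0 | h0
    · left
      refine ⟨sgn i * ((excess i : ℤ) + 3), ?_, by simp [letter, mkWord, h0]⟩
      rcases sgn_cases i with h | h <;> rw [h, abs_mul] <;> simp <;>
        exact le_trans (by omega) (le_abs_self _)
    · rcases sgn_cases i with h | h
      · right; left
        exact ⟨twos i, h0, (excess i : ℤ) + 3, by omega, by simp [letter, mkWord, h]⟩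
      · right; right
        exact ⟨twos i, h0, -((excess i : ℤ) + 3), by omega, by simp [letter, mkWord, h]⟩
  · have key : ∀ j : ℕ, ∀ b : ℤ, 3 ≤ b → ∀ ε : ℤ, ε = 1 ∨ ε = -1 →
        List.replicate j (2 * ε) ++ [ε * b] ∈ Set.range letter := by
      intro j b hb ε hε
      obtain ⟨i, hi⟩ := exists_letter_eq_mkWord hε j (b - 3).toNat
      refine ⟨i, ?_⟩
      rw [hi, mkWord, Int.toNat_of_nonneg (by omega)]
      simp
    rintro (⟨b, hb, rfl⟩ | ⟨j, -, b, hb, rfl⟩ | ⟨j, -, b, hb, rfl⟩)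
    · rcases le_abs.1 hb with h | h
      · simpa using key 0 b h 1 (Or.inl rfl)
      · simpa using key 0 (-b) h (-1) (Or.inr rfl)
    · simpa using key j b hb 1 (Or.inl rfl)
    · simpa using key j (-b) (by omega) (-1) (Or.inr rfl)

lemma adm_replicate {ε : ℤ} (hε : ε = 1 ∨ ε = -1) (j : ℕ) : Adm (List.replicate j (2 * ε)) := by
  intro b hb
  rw [List.eq_of_mem_replicate hb]
  rcases hε with rfl | rfl <;> norm_num

lemma three_le_abs_last {ε : ℤ} (hε : ε = 1 ∨ ε = -1) (m : ℕ) : 3 ≤ |ε * ((m : ℤ) + 3)| := by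
  rcases hε with rfl | rfl <;> rw [abs_mul] <;> simp <;>
    exact le_trans (by omega) (le_abs_self _)

lemma adm_mkWord {ε : ℤ} (hε : ε = 1 ∨ ε = -1) (j m : ℕ) : Adm (mkWord ε j m) := by
  refine (adm_replicate hε j).append ?_
  intro b hb
  rw [List.mem_singleton.1 hb]
  have := three_le_abs_last hε m
  omega

lemma adm_letter (i : ℕ) : Adm (letter i) := adm_mkWord (sgn_cases i) _ _

lemma digits_nil : digits [] = [] := rfl

lemma digits_append (l l' : List ℕ) : digits (l ++ l') = digits l ++ digits l' := by
  simp [digits]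

lemma digits_singleton (i : ℕ) : digits [i] = letter i := by simp [digits]

lemma adm_digits (l : List ℕ) : Adm (digits l) := by
  induction l with
  | nil => intro b hb; simp [digits_nil] at hb
  | cons i l ih =>
    rw [← List.singleton_append, digits_append, digits_singleton]
    exact (adm_letter i).append ih

lemma mkWord_succ (ε : ℤ) (j m : ℕ) : mkWord ε (j + 1) m = (2 * ε) :: mkWord ε j m := by
  simp [mkWord, List.replicate_succ]

lemma comp_mkWord_mem {ε : ℤ} (hε : ε = 1 ∨ ε = -1) (j m : ℕ) {x : ℝ} (hx : |x| ≤ 1 / 2) :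
    0 < ε * nicfComp (mkWord ε j m) x ∧ ε * nicfComp (mkWord ε j m) x < 1 / 2 := by
  have hm : (0 : ℝ) ≤ m := Nat.cast_nonneg m
  have hx' := abs_le.1 hx
  induction j with
  | zero =>
    simp only [mkWord, List.replicate_zero, List.nil_append, comp_singleton]
    rcases hε with rfl | rfl
    · push_cast
      rw [one_mul, one_mul]
      have h : (0 : ℝ) < (m : ℝ) + 3 + x := by linarith
      exact ⟨by positivity, by rw [div_lt_div_iff₀ h (by norm_num)]; linarith⟩
    · push_cast
      have h : (0 : ℝ) < (m : ℝ) + 3 - x := by linarith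
      have h2 : -1 * (1 / (-1 * ((m : ℝ) + 3) + x)) = 1 / ((m : ℝ) + 3 - x) := by
        rw [show -1 * ((m : ℝ) + 3) + x = -((m : ℝ) + 3 - x) by ring, one_div_neg_eq_neg_one_div]
        ring
      rw [h2]
      exact ⟨by positivity, by rw [div_lt_div_iff₀ h (by norm_num)]; linarith⟩
  | succ j ih =>
    rw [mkWord_succ, comp_cons]
    obtain ⟨ih1, ih2⟩ := ih
    generalize nicfComp (mkWord ε j m) x = y at ih1 ih2 ⊢
    rcases hε with rfl | rfl
    · push_cast at ih1 ih2 ⊢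
      have h : (0 : ℝ) < 2 + y := by linarith
      rw [one_mul]
      exact ⟨by positivity, by rw [div_lt_div_iff₀ h (by norm_num)]; linarith⟩
    · push_cast at ih1 ih2 ⊢
      have h : (0 : ℝ) < 2 - y := by linarith
      have h2 : -1 * (1 / (-2 + y)) = 1 / (2 - y) := by
        rw [show -2 + y = -(2 - y) by ring, one_div_neg_eq_neg_one_div]
        ring
      rw [h2]
      exact ⟨by positivity, by rw [div_lt_div_iff₀ h (by norm_num)]; linarith⟩

lemma abs_comp_mkWord_lt {ε : ℤ} (hε : ε = 1 ∨ ε = -1) (j m : ℕ) {x : ℝ} (hx : |x| ≤ 1 / 2) :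
    |nicfComp (mkWord ε j m) x| < 1 / 2 := by
  have := comp_mkWord_mem hε j m hx
  rw [abs_lt]
  rcases hε with rfl | rfl <;> push_cast at this <;> constructor <;> linarith

lemma abs_comp_letter_lt (i : ℕ) {x : ℝ} (hx : |x| ≤ 1 / 2) : |nicfComp (letter i) x| < 1 / 2 :=
  abs_comp_mkWord_lt (sgn_cases i) _ _ hx

lemma comp_digits_cons (i : ℕ) (l : List ℕ) (x : ℝ) :
    nicfComp (digits (i :: l)) x = nicfComp (letter i) (nicfComp (digits l) x) := by
  rw [← List.singleton_append, digits_append, digits_singleton, comp_append]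

lemma abs_comp_digits_le (l : List ℕ) {x : ℝ} (hx : |x| ≤ 1 / 2) :
    |nicfComp (digits l) x| ≤ 1 / 2 := by
  induction l with
  | nil => simpa [digits_nil, comp_nil] using hx
  | cons i l ih =>
    rw [comp_digits_cons]
    exact (abs_comp_letter_lt i ih).le

lemma abs_comp_digits_lt (l : List ℕ) {x : ℝ} (hx : |x| < 1 / 2) :
    |nicfComp (digits l) x| < 1 / 2 := by
  cases l with
  | nil => simpa [digits_nil, comp_nil] using hx
  | cons i l =>
    rw [comp_digits_cons]
    exact abs_comp_letter_lt i (abs_comp_digits_le l hx.le)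

/-! ### Recovering the letters from a point -/

lemma eq_of_inv_add_eq {a b : ℤ} {x y : ℝ} (hx : |x| < 1 / 2) (hy : |y| < 1 / 2)
    (h : 1 / ((a : ℝ) + x) = 1 / ((b : ℝ) + y)) : a = b ∧ x = y := by
  have h1 : (a : ℝ) + x = b + y := by simpa using h
  have hx := abs_lt.1 hx
  have hy := abs_lt.1 hy
  have h2 : a = b := by
    have h3 : a < b + 1 := by
      have : (a : ℝ) < b + 1 := by linarith
      exact_mod_cast this
    have h4 : b < a + 1 := by
      have : (b : ℝ) < a + 1 := by linarith
      exact_mod_cast this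
    omega
  subst h2
  exact ⟨rfl, by linarith⟩

lemma comp_mkWord_inj {ε ε' : ℤ} (hε : ε = 1 ∨ ε = -1) (hε' : ε' = 1 ∨ ε' = -1) {j j' m m' : ℕ}
    {x y : ℝ} (hx : |x| < 1 / 2) (hy : |y| < 1 / 2)
    (h : nicfComp (mkWord ε j m) x = nicfComp (mkWord ε' j' m') y) :
    ε = ε' ∧ j = j' ∧ m = m' ∧ x = y := by
  induction j generalizing j' with
  | zero =>
    cases j' with
    | zero =>
      obtain ⟨h1, h2⟩ := eq_of_inv_add_eq hx hy h
      refine ⟨?_, rfl, ?_, h2⟩ <;> rcases hε with rfl | rfl <;> rcases hε' with rfl | rfl <;> omega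
    | succ j' =>
      rw [mkWord_succ] at h
      obtain ⟨h1, -⟩ := eq_of_inv_add_eq hx (abs_comp_mkWord_lt hε' j' m' hy.le) h
      rcases hε with rfl | rfl <;> rcases hε' with rfl | rfl <;> omega
  | succ j ih =>
    rw [mkWord_succ] at h
    cases j' with
    | zero =>
      obtain ⟨h1, -⟩ := eq_of_inv_add_eq (abs_comp_mkWord_lt hε j m hx.le) hy h
      rcases hε with rfl | rfl <;> rcases hε' with rfl | rfl <;> omega
    | succ j' =>
      rw [mkWord_succ] at h
      obtain ⟨-, h2⟩ := eq_of_inv_add_eq (abs_comp_mkWord_lt hε j m hx.le)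
        (abs_comp_mkWord_lt hε' j' m' hy.le) h
      obtain ⟨a, b, c, d⟩ := ih h2
      exact ⟨a, by rw [b], c, d⟩

lemma comp_letter_inj {i i' : ℕ} {x y : ℝ} (hx : |x| < 1 / 2) (hy : |y| < 1 / 2)
    (h : nicfComp (letter i) x = nicfComp (letter i') y) : i = i' ∧ x = y := by
  obtain ⟨h1, h2, h3, h4⟩ := comp_mkWord_inj (sgn_cases i) (sgn_cases i') hx hy h
  exact ⟨eq_of_sgn_twos_excess h1 h2 h3, h4⟩

lemma comp_digits_inj {l l' : List ℕ} (hl : l.length = l'.length) {x y : ℝ} (hx : |x| < 1 / 2)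
    (hy : |y| < 1 / 2) (h : nicfComp (digits l) x = nicfComp (digits l') y) : l = l' := by
  induction l generalizing l' with
  | nil => exact (List.length_eq_zero_iff.1 hl.symm).symm
  | cons i l ih =>
    cases l' with
    | nil => simp at hl
    | cons i' l' =>
      rw [comp_digits_cons, comp_digits_cons] at h
      obtain ⟨rfl, h2⟩ := comp_letter_inj (abs_comp_digits_lt l hx) (abs_comp_digits_lt l' hy) h
      rw [ih (by simpa using hl) h2]

/-! ### Growth of denominators -/

lemma abs_snd_le_of_last {u : List ℤ} (hu : Adm u) {b : ℤ} (hb : 3 ≤ |b|) :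
    2 * |(qp (u ++ [b])).2| ≤ |(qp (u ++ [b])).1| := by
  rw [qp_concat]
  have h1 := hu.abs_snd_lt
  have h2 := abs_mul_sub_le (b : ℝ) (qp u).1 (qp u).2
  have h3 : (3 : ℝ) ≤ |(b : ℝ)| := by exact_mod_cast hb
  have := mul_le_mul_of_nonneg_right h3 (abs_nonneg (qp u).1)
  simp only
  linarith

lemma abs_snd_digits_le (l : List ℕ) : 2 * |(qp (digits l)).2| ≤ |(qp (digits l)).1| := by
  induction l using List.reverseRecOn with
  | nil => simp [digits_nil, qp_nil]
  | append_singleton l i _ =>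
    rw [digits_append, digits_singleton, letter, mkWord, ← List.append_assoc]
    exact abs_snd_le_of_last ((adm_digits l).append (adm_replicate (sgn_cases i) _))
      (three_le_abs_last (sgn_cases i) _)

lemma abs_fst_le_append {u v : List ℤ} (h : Adm (u ++ v)) : |(qp u).1| ≤ |(qp (u ++ v)).1| := by
  induction v using List.reverseRecOn with
  | nil => simp
  | append_singleton v b ih =>
    rw [← List.append_assoc] at h ⊢
    have h1 := h.abs_snd_lt
    have h2 := ih h.left
    rw [qp_concat] at h1 ⊢
    simp only at *
    linarith

lemma two_pow_le_abs_fst (l : List ℕ) : (2 : ℝ) ^ l.length ≤ |(qp (digits l)).1| := by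
  induction l using List.reverseRecOn with
  | nil => simp [digits_nil, qp_nil]
  | append_singleton l i ih =>
    have h0 := (adm_digits l).append (adm_replicate (sgn_cases i) (twos i))
    have h1 := abs_snd_le_of_last h0 (three_le_abs_last (sgn_cases i) (excess i))
    have h2 := abs_fst_le_append h0
    rw [digits_append, digits_singleton, letter, mkWord, ← List.append_assoc]
    rw [qp_concat] at h1 ⊢
    simp only [List.length_append, List.length_singleton, pow_succ] at *
    linarith

lemma twos_le_abs_fst (i : ℕ) : (twos i : ℝ) ≤ |(qp (letter i)).1| := by
  have h := (adm_letter i).length_lt_abs_fst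
  have h2 : (letter i).length = twos i + 1 := by simp [letter, mkWord]
  rw [h2] at h
  push_cast at h
  linarith

lemma excess_le_abs_fst (i : ℕ) : (excess i : ℝ) ≤ |(qp (letter i)).1| := by
  have h0 := adm_replicate (sgn_cases i) (twos i)
  have h1 := h0.abs_snd_lt
  have h2 := h0.one_le_abs_fst
  rw [letter, mkWord, qp_concat]
  set q := (qp (List.replicate (twos i) (2 * sgn i))).1
  set p := (qp (List.replicate (twos i) (2 * sgn i))).2
  have h3 := abs_mul_sub_le ((sgn i * ((excess i : ℤ) + 3) : ℤ) : ℝ) q p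
  have h4 : |((sgn i * ((excess i : ℤ) + 3) : ℤ) : ℝ)| = (excess i : ℝ) + 3 := by
    have h5 : |((excess i : ℝ) + 3)| = (excess i : ℝ) + 3 := abs_of_nonneg (by positivity)
    rcases sgn_cases i with h | h <;> rw [h] <;> push_cast <;> rw [abs_mul, h5] <;> simp
  rw [h4] at h3
  have h6 : (0 : ℝ) ≤ excess i := Nat.cast_nonneg _
  simp only
  nlinarith

lemma finite_abs_fst_le (B : ℝ) : {i : ℕ | |(qp (letter i)).1| ≤ B}.Finite := by
  obtain ⟨K, hK⟩ := exists_nat_ge B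
  have h : Set.Finite ((fun x : ℕ × ℕ × ℕ => 2 * Nat.pair x.1 x.2.1 + x.2.2) ''
      (Set.Iic K ×ˢ Set.Iic K ×ˢ Set.Iic 1)) :=
    ((Set.finite_Iic K).prod ((Set.finite_Iic K).prod (Set.finite_Iic 1))).image _
  refine h.subset fun i hi => ⟨(twos i, excess i, i % 2), ⟨?_, ?_, ?_⟩, ?_⟩
  · have := (twos_le_abs_fst i).trans (le_trans hi hK)
    exact_mod_cast this
  · have := (excess_le_abs_fst i).trans (le_trans hi hK)
    exact_mod_cast this
  · simp only [Set.mem_Iic]; omega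
  · simp only [twos, excess, Nat.pair_unpair]; omega

/-! ### Weights of finite sequences of letters -/

/-- The reciprocal of the squared denominator at `0` of the map coded by `l`, to the power `s`. -/
noncomputable def weight (s : ℝ) (l : List ℕ) : ℝ≥0∞ :=
  ENNReal.ofReal (((qp (digits l)).1 ^ 2)⁻¹) ^ s

lemma one_le_fst_sq {u : List ℤ} (h : Adm u) : 1 ≤ (qp u).1 ^ 2 := by
  rw [← sq_abs]
  exact one_le_pow₀ h.one_le_abs_fst

lemma fst_digits_append (l l' : List ℕ) :
    (qp (digits (l ++ l'))).1 =
      den (digits l) (nicfComp (digits l') 0) * (qp (digits l')).1 := by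
  rw [← den_zero, digits_append, den_append _ (adm_digits l') (by simp), den_zero]

lemma abs_comp_digits_zero_le (l : List ℕ) : |nicfComp (digits l) 0| ≤ 1 / 2 :=
  abs_comp_digits_le l (by norm_num)

lemma inv_sq_append_le (l l' : List ℕ) :
    ((qp (digits (l ++ l'))).1 ^ 2)⁻¹ ≤
      4 * (((qp (digits l)).1 ^ 2)⁻¹ * ((qp (digits l')).1 ^ 2)⁻¹) := by
  have h1 := one_le_fst_sq (adm_digits l)
  have h2 := one_le_fst_sq (adm_digits l')
  have h3 := (adm_digits l).le_abs_den (abs_comp_digits_zero_le l')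
  rw [fst_digits_append, mul_pow, mul_inv, ← mul_assoc]
  refine mul_le_mul_of_nonneg_right ?_ (by positivity)
  rw [← sq_abs (den _ _), ← sq_abs (qp (digits l)).1] at *
  have h4 : |(qp (digits l)).1| ^ 2 / 4 ≤ |den (digits l) (nicfComp (digits l') 0)| ^ 2 := by
    calc |(qp (digits l)).1| ^ 2 / 4 = (|(qp (digits l)).1| / 2) ^ 2 := by ring
      _ ≤ _ := by gcongr
  rw [← div_eq_mul_inv, inv_eq_one_div, div_le_div_iff₀ (by linarith) (by linarith)]
  linarith

lemma inv_sq_mul_le (l l' : List ℕ) :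
    ((qp (digits l)).1 ^ 2)⁻¹ * ((qp (digits l')).1 ^ 2)⁻¹ ≤
      9 / 4 * ((qp (digits (l ++ l'))).1 ^ 2)⁻¹ := by
  have h1 := one_le_fst_sq (adm_digits l)
  have h2 := one_le_fst_sq (adm_digits l')
  have h3 := (adm_digits l).abs_den_le (abs_comp_digits_zero_le l')
  have h5 := (adm_digits l).le_abs_den (abs_comp_digits_zero_le l')
  have h6 := (adm_digits l).one_le_abs_fst
  rw [fst_digits_append, mul_pow, mul_inv, ← mul_assoc]
  refine mul_le_mul_of_nonneg_right ?_ (by positivity)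
  rw [← sq_abs (den _ _), ← sq_abs (qp (digits l)).1] at *
  have h4 : |den (digits l) (nicfComp (digits l') 0)| ^ 2 ≤ 9 / 4 * |(qp (digits l)).1| ^ 2 := by
    calc |den (digits l) (nicfComp (digits l') 0)| ^ 2 ≤ (3 / 2 * |(qp (digits l)).1|) ^ 2 := by
          gcongr
      _ = _ := by ring
  have h7 : 0 < |den (digits l) (nicfComp (digits l') 0)| := by linarith
  rw [← div_eq_mul_inv, inv_eq_one_div, div_le_div_iff₀ (by linarith) (by positivity)]
  linarith

lemma rpow_le_self_of_one_le {c : ℝ≥0∞} (hc : 1 ≤ c) {s : ℝ} (hs : s ≤ 1) : c ^ s ≤ c := by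
  conv_rhs => rw [← ENNReal.rpow_one c]
  exact ENNReal.rpow_le_rpow_of_exponent_le hc hs

lemma weight_append_le {s : ℝ} (h0 : 0 ≤ s) (h1 : s ≤ 1) (l l' : List ℕ) :
    weight s (l ++ l') ≤ 4 * (weight s l * weight s l') := by
  unfold weight
  rw [← ENNReal.mul_rpow_of_nonneg _ _ h0, ← ENNReal.ofReal_mul (by positivity)]
  calc _ ≤ ENNReal.ofReal (4 * (((qp (digits l)).1 ^ 2)⁻¹ * ((qp (digits l')).1 ^ 2)⁻¹)) ^ s :=
        ENNReal.rpow_le_rpow (ENNReal.ofReal_le_ofReal (inv_sq_append_le l l')) h0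
    _ = 4 ^ s * _ := by
        rw [ENNReal.ofReal_mul (by norm_num), ENNReal.mul_rpow_of_nonneg _ _ h0,
          ENNReal.ofReal_ofNat]
    _ ≤ _ := by gcongr; exact rpow_le_self_of_one_le (by norm_num) h1

lemma weight_mul_le {s : ℝ} (h0 : 0 ≤ s) (h1 : s ≤ 1) (l l' : List ℕ) :
    weight s l * weight s l' ≤ ENNReal.ofReal (9 / 4) * weight s (l ++ l') := by
  unfold weight
  rw [← ENNReal.mul_rpow_of_nonneg _ _ h0, ← ENNReal.ofReal_mul (by positivity)]
  calc _ ≤ ENNReal.ofReal (9 / 4 * ((qp (digits (l ++ l'))).1 ^ 2)⁻¹) ^ s :=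
        ENNReal.rpow_le_rpow (ENNReal.ofReal_le_ofReal (inv_sq_mul_le l l')) h0
    _ = ENNReal.ofReal (9 / 4) ^ s * _ := by
        rw [ENNReal.ofReal_mul (by norm_num), ENNReal.mul_rpow_of_nonneg _ _ h0]
    _ ≤ _ := by
        gcongr
        exact rpow_le_self_of_one_le (by rw [ENNReal.one_le_ofReal]; norm_num) h1

lemma weight_nil (s : ℝ) : weight s [] = 1 := by
  simp [weight, digits_nil, qp_nil]

/-! ### Replacing a letter by later letters -/

lemma inv_sq_le_sum {c : ℝ} (hc : 2 ≤ c) :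
    (c ^ 2)⁻¹ ≤ ∑ r ∈ Finset.range 9, ((c + ((r + 1 : ℕ) : ℝ)) ^ 2)⁻¹ := by
  have h1 : ∀ r ∈ Finset.range 9, 1 / (c + 1 + (r : ℝ)) - 1 / (c + 1 + ((r + 1 : ℕ) : ℝ)) ≤
      ((c + ((r + 1 : ℕ) : ℝ)) ^ 2)⁻¹ := by
    intro r _
    push_cast
    have hr : (0 : ℝ) ≤ r := Nat.cast_nonneg r
    have h2 : (0 : ℝ) < c + 1 + r := by linarith
    have h3 : (0 : ℝ) < c + 1 + (r + 1) := by linarith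
    rw [div_sub_div _ _ h2.ne' h3.ne', inv_eq_one_div, div_le_div_iff₀ (by positivity)
      (by positivity)]
    nlinarith
  refine le_trans ?_ (Finset.sum_le_sum h1)
  rw [Finset.sum_range_sub' (fun r : ℕ => 1 / (c + 1 + (r : ℝ)))]
  push_cast
  rw [div_sub_div _ _ (by linarith) (by linarith), inv_eq_one_div,
    div_le_div_iff₀ (by positivity) (by positivity)]
  nlinarith

/-- The ratio `p / q` after digits `±2` appended to a sequence of letters is at least `-1/2` in the
direction of the sign. -/
lemma sgn_mul_ratio {ε : ℤ} (hε : ε = 1 ∨ ε = -1) (l : List ℕ) (j : ℕ) :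
    -(1 / 2) ≤ ε * ((qp (digits l ++ List.replicate j (2 * ε))).2 /
      (qp (digits l ++ List.replicate j (2 * ε))).1) := by
  have hq : ∀ j, 1 ≤ |(qp (digits l ++ List.replicate j (2 * ε))).1| := fun j =>
    ((adm_digits l).append (adm_replicate hε j)).one_le_abs_fst
  induction j with
  | zero =>
    have h1 := abs_snd_digits_le l
    have h2 := (adm_digits l).one_le_abs_fst
    simp only [List.replicate_zero, List.append_nil]
    have h3 : |(qp (digits l)).2 / (qp (digits l)).1| ≤ 1 / 2 := by
      rw [abs_div, div_le_div_iff₀ (by linarith) (by norm_num)]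
      linarith
    have := abs_le.1 h3
    rcases hε with rfl | rfl <;> push_cast <;> linarith
  | succ j ih =>
    have h1 := hq j
    rw [List.replicate_succ', ← List.append_assoc, qp_concat]
    generalize (qp (digits l ++ List.replicate j (2 * ε))).1 = q at *
    generalize (qp (digits l ++ List.replicate j (2 * ε))).2 = p at *
    have hq0 : q ≠ 0 := ne_zero_of_one_le_abs h1
    have h2 : (ε : ℝ) * (q / (((2 * ε : ℤ) : ℝ) * q + p)) = 1 / (2 + ε * (p / q)) := by
      have h3 : 2 + ε * (p / q) ≠ 0 := by linarith
      have h4 : ((2 * ε : ℤ) : ℝ) * q + p = (2 + ε * (p / q)) * (ε * q) := by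
        rcases hε with rfl | rfl <;> push_cast <;> field_simp
        ring
      have h5 : (ε : ℝ) ≠ 0 := by rcases hε with rfl | rfl <;> norm_num
      rw [h4]
      generalize 2 + ε * (p / q) = z at *
      field_simp
    simp only [h2]
    have : 0 < 2 + ε * (p / q) := by linarith
    have : 0 < 1 / (2 + ε * (p / q)) := by positivity
    linarith

lemma fst_sq_letter (l l' : List ℕ) (i : ℕ) : ∃ c : ℝ, 2 ≤ c ∧ ∃ B : ℝ, ∀ r : ℕ,
    (qp (digits (l ++ [shiftLetter i r] ++ l'))).1 ^ 2 = B * (c + r) ^ 2 := by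
  have hε := sgn_cases i
  set u := digits l ++ List.replicate (twos i) (2 * sgn i) with hu
  have hadm : Adm u := (adm_digits l).append (adm_replicate hε _)
  have hq0 : (qp u).1 ≠ 0 := ne_zero_of_one_le_abs hadm.one_le_abs_fst
  have hα := sgn_mul_ratio hε l (twos i)
  rw [← hu] at hα
  set y := nicfComp (digits l') 0 with hy
  have hy' : |y| ≤ 1 / 2 := abs_comp_digits_zero_le l'
  refine ⟨excess i + 3 + sgn i * (y + (qp u).2 / (qp u).1), ?_,
    (qp u).1 ^ 2 * (qp (digits l')).1 ^ 2, ?_⟩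
  · have h1 : (0 : ℝ) ≤ excess i := Nat.cast_nonneg _
    have h2 : -(1 / 2) ≤ sgn i * y := by
      have := abs_le.1 hy'
      rcases hε with h | h <;> rw [h] <;> push_cast <;> linarith
    rw [mul_add]
    linarith
  · intro r
    rw [fst_digits_append, ← hy, digits_append, digits_singleton, letter_shiftLetter, mkWord,
      ← List.append_assoc, ← hu, den, qp_concat]
    push_cast
    have hs : (sgn i : ℝ) ^ 2 = 1 := by rcases hε with h | h <;> rw [h] <;> norm_num
    have h3 : (sgn i : ℝ) * (excess i + r + 3) * (qp u).1 + (qp u).2 + (qp u).1 * y =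
        sgn i * (qp u).1 * (excess i + 3 + sgn i * (y + (qp u).2 / (qp u).1) + r) := by
      have h4 : (sgn i : ℝ) * (qp u).1 * (excess i + 3 + sgn i * (y + (qp u).2 / (qp u).1) + r) =
        sgn i * (qp u).1 * (excess i + 3 + r) +
          (sgn i : ℝ) ^ 2 * ((qp u).1 * (y + (qp u).2 / (qp u).1)) := by ring
      rw [h4, hs]
      field_simp
      ring
    rw [h3, mul_pow, mul_pow, mul_pow, hs]
    ring

lemma rpow_sum_le_sum_rpow {ι : Type*} (t : Finset ι) (f : ι → ℝ≥0∞) {s : ℝ} (h0 : 0 ≤ s)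
    (h1 : s ≤ 1) (ht : t.Nonempty) : (∑ i ∈ t, f i) ^ s ≤ ∑ i ∈ t, f i ^ s := by
  induction ht using Finset.Nonempty.cons_induction with
  | singleton a => simp
  | cons a t ha _ ih =>
    rw [Finset.sum_cons, Finset.sum_cons]
    exact (ENNReal.rpow_add_le_add_rpow _ _ h0 h1).trans (by gcongr)

lemma weight_letter_le {s : ℝ} (h0 : 0 ≤ s) (h1 : s ≤ 1) (l l' : List ℕ) (i : ℕ) :
    weight s (l ++ [i] ++ l') ≤
      ∑ r ∈ Finset.range 9, weight s (l ++ [shiftLetter i (r + 1)] ++ l') := by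
  obtain ⟨c, hc, B, hB⟩ := fst_sq_letter l l' i
  have hB0 : 0 ≤ B := by
    have h := one_le_fst_sq (adm_digits (l ++ [shiftLetter i 0] ++ l'))
    rw [hB] at h
    by_contra hneg
    have : B * (c + (0 : ℕ)) ^ 2 ≤ 0 := mul_nonpos_of_nonpos_of_nonneg (by linarith) (sq_nonneg _)
    linarith
  refine le_trans ?_ (rpow_sum_le_sum_rpow _ _ h0 h1 (by simp))
  refine ENNReal.rpow_le_rpow ?_ h0
  rw [← ENNReal.ofReal_sum_of_nonneg (fun r _ => by positivity)]
  refine ENNReal.ofReal_le_ofReal ?_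
  have h2 := hB 0
  rw [shiftLetter_zero] at h2
  rw [h2]
  simp only [hB, mul_inv, ← Finset.mul_sum]
  have := inv_sq_le_sum hc
  refine mul_le_mul_of_nonneg_left ?_ (by positivity)
  simpa using this

/-! ### Partition sums -/

/-- The sum of the weights of all extensions of `l` by `k` letters from `N`. -/
noncomputable def psum (s : ℝ) (N : Set ℕ) : ℕ → List ℕ → ℝ≥0∞
  | 0, l => weight s l
  | k + 1, l => ∑' i, N.indicator (fun i => psum s N k (l ++ [i])) i

/-- The partition sums of the system with letters `N` stay below the distortion constant. -/
def Good (s : ℝ) (N : Set ℕ) : Prop := ∀ k, psum s N k [] ≤ ENNReal.ofReal (9 / 4)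

lemma psum_zero (s : ℝ) (N : Set ℕ) (l : List ℕ) : psum s N 0 l = weight s l := rfl

lemma psum_succ (s : ℝ) (N : Set ℕ) (k : ℕ) (l : List ℕ) :
    psum s N (k + 1) l = ∑' i, N.indicator (fun i => psum s N k (l ++ [i])) i := rfl

lemma indicator_le_of_subset {N M : Set ℕ} (h : N ⊆ M) {f g : ℕ → ℝ≥0∞} (hfg : ∀ i, f i ≤ g i)
    (i : ℕ) : N.indicator f i ≤ M.indicator g i := by
  by_cases hi : i ∈ N
  · simpa [hi, h hi] using hfg i
  · simp [hi]

lemma psum_mono (s : ℝ) {N M : Set ℕ} (h : N ⊆ M) (k : ℕ) (l : List ℕ) :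
    psum s N k l ≤ psum s M k l := by
  induction k generalizing l with
  | zero => rfl
  | succ k ih =>
    rw [psum_succ, psum_succ]
    exact ENNReal.tsum_le_tsum (indicator_le_of_subset h fun i => ih _)

lemma Good.mono {s : ℝ} {N M : Set ℕ} (h : N ⊆ M) (hM : Good s M) : Good s N :=
  fun k => (psum_mono s h k []).trans (hM k)

lemma tsum_iSup_of_monotone {f : ℕ → ℕ → ℝ≥0∞} (hf : Monotone f) :
    ∑' i, ⨆ n, f n i = ⨆ n, ∑' i, f n i := by
  simp_rw [ENNReal.tsum_eq_iSup_sum]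
  rw [iSup_comm]
  refine iSup_congr fun t => ?_
  exact ENNReal.finsetSum_iSup_of_monotone fun i n m h => hf h i

lemma psum_iUnion (s : ℝ) {N : ℕ → Set ℕ} (hN : Monotone N) (k : ℕ) (l : List ℕ) :
    psum s (⋃ n, N n) k l = ⨆ n, psum s (N n) k l := by
  induction k generalizing l with
  | zero => simp [psum_zero]
  | succ k ih =>
    simp_rw [psum_succ]
    rw [← tsum_iSup_of_monotone]
    · refine tsum_congr fun i => ?_
      by_cases hi : i ∈ ⋃ n, N n
      · rw [Set.indicator_of_mem hi, ih]
        obtain ⟨n₀, hn₀⟩ := Set.mem_iUnion.1 hi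
        refine le_antisymm (iSup_le fun n => ?_) (iSup_mono fun n => Set.indicator_le_self _ _ _)
        refine le_trans ?_ (le_iSup _ (max n n₀))
        rw [Set.indicator_of_mem (hN (le_max_right _ _) hn₀)]
        exact psum_mono s (hN (le_max_left _ _)) k _
      · rw [Set.indicator_of_notMem hi]
        have : ∀ n, i ∉ N n := fun n hn => hi (Set.mem_iUnion.2 ⟨n, hn⟩)
        simp [this]
    · intro n m h
      exact indicator_le_of_subset (hN h) fun i => psum_mono s (hN h) k _

lemma Good.iUnion {s : ℝ} {N : ℕ → Set ℕ} (hN : Monotone N) (h : ∀ n, Good s (N n)) :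
    Good s (⋃ n, N n) := by
  intro k
  rw [psum_iUnion s hN]
  exact iSup_le fun n => h n k

lemma tsum_indicator_le_mul {N : Set ℕ} {f g : ℕ → ℝ≥0∞} {c : ℝ≥0∞} (h : ∀ i, f i ≤ c * g i) :
    ∑' i, N.indicator f i ≤ c * ∑' i, N.indicator g i := by
  rw [← ENNReal.tsum_mul_left]
  refine ENNReal.tsum_le_tsum fun i => ?_
  by_cases hi : i ∈ N <;> simp [hi, h]

lemma psum_append_le {s : ℝ} (h0 : 0 ≤ s) (h1 : s ≤ 1) (N : Set ℕ) (k : ℕ) (l l' : List ℕ) :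
    psum s N k (l ++ l') ≤ 4 * weight s l * psum s N k l' := by
  induction k generalizing l' with
  | zero => rw [psum_zero, psum_zero, mul_assoc]; exact weight_append_le h0 h1 l l'
  | succ k ih =>
    rw [psum_succ, psum_succ]
    refine tsum_indicator_le_mul fun i => ?_
    rw [List.append_assoc]
    exact ih _

lemma weight_mul_psum_le {s : ℝ} (h0 : 0 ≤ s) (h1 : s ≤ 1) (N : Set ℕ) (k : ℕ) (l l' : List ℕ) :
    weight s l * psum s N k l' ≤ ENNReal.ofReal (9 / 4) * psum s N k (l ++ l') := by
  induction k generalizing l' with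
  | zero => exact weight_mul_le h0 h1 l l'
  | succ k ih =>
    rw [psum_succ, psum_succ, ← ENNReal.tsum_mul_left, ← ENNReal.tsum_mul_left]
    refine ENNReal.tsum_le_tsum fun i => ?_
    by_cases hi : i ∈ N
    · simpa [hi] using ih (l' ++ [i])
    · simp [hi]

lemma psum_mul_le {s : ℝ} (h0 : 0 ≤ s) (h1 : s ≤ 1) (N : Set ℕ) (k m : ℕ) (l : List ℕ) :
    psum s N k l * psum s N m [] ≤ ENNReal.ofReal (9 / 4) * psum s N (k + m) l := by
  induction k generalizing l with
  | zero =>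
    rw [zero_add]
    simpa [psum_zero] using weight_mul_psum_le h0 h1 N m l []
  | succ k ih =>
    rw [show k + 1 + m = (k + m) + 1 by ring, psum_succ, psum_succ, ← ENNReal.tsum_mul_right,
      ← ENNReal.tsum_mul_left]
    refine ENNReal.tsum_le_tsum fun i => ?_
    by_cases hi : i ∈ N
    · simpa [hi] using ih (l ++ [i])
    · simp [hi]

lemma good_of_bounded {s : ℝ} (h0 : 0 ≤ s) (h1 : s ≤ 1) {N : Set ℕ} {C : ℝ≥0∞} (hC : C ≠ ∞)
    (h : ∀ k, psum s N k [] ≤ C) : Good s N := by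
  intro k
  set M := ⨆ m, psum s N m [] with hM
  have hM1 : 1 ≤ M := by
    have := le_iSup (fun m => psum s N m []) 0
    rwa [psum_zero, weight_nil] at this
  have hM2 : M ≠ ∞ := ne_top_of_le_ne_top hC (iSup_le h)
  have h2 : psum s N k [] * M ≤ ENNReal.ofReal (9 / 4) * M := by
    rw [hM, ENNReal.mul_iSup]
    refine iSup_le fun m => (psum_mul_le h0 h1 N k m []).trans ?_
    gcongr
    exact le_iSup (fun m => psum s N m []) (k + m)
  exact (ENNReal.mul_le_mul_iff_left (zero_lt_one.trans_le hM1).ne' hM2).1 h2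

lemma good_empty (s : ℝ) : Good s ∅ := by
  intro k
  cases k with
  | zero => rw [psum_zero, weight_nil, ENNReal.one_le_ofReal]; norm_num
  | succ k => simp [psum_succ]

/-! ### Replacing a letter in partition sums -/

lemma psum_letter_le {s : ℝ} (h0 : 0 ≤ s) (h1 : s ≤ 1) (N : Set ℕ) (k : ℕ) (l l' : List ℕ) (i : ℕ) :
    psum s N k (l ++ [i] ++ l') ≤
      ∑ r ∈ Finset.range 9, psum s N k (l ++ [shiftLetter i (r + 1)] ++ l') := by
  induction k generalizing l' with
  | zero => exact weight_letter_le h0 h1 l l' i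
  | succ k ih =>
    simp_rw [psum_succ]
    rw [← Summable.tsum_finsetSum (fun _ _ => ENNReal.summable)]
    refine ENNReal.tsum_le_tsum fun f => ?_
    by_cases hf : f ∈ N
    · simpa [hf] using ih (l' ++ [f])
    · simp [hf]

lemma psum_insert_le {s : ℝ} (h0 : 0 ≤ s) (h1 : s ≤ 1) {N M : Set ℕ} {i : ℕ} (hN : ∀ n ∈ N, n < i)
    (hNM : N ⊆ M) (hM : ∀ n, i < n → n ∈ M) (k : ℕ) (l : List ℕ) :
    psum s (insert i N) k l ≤ psum s M k l := by
  induction k generalizing l with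
  | zero => rfl
  | succ k ih =>
    set T : Finset ℕ := (Finset.range 9).image (fun r => shiftLetter i (r + 1)) with hT
    have hlt : ∀ n ∈ T, i < n := by
      intro n hn
      obtain ⟨r, -, rfl⟩ := Finset.mem_image.1 hn
      have := shiftLetter_strictMono i (Nat.succ_pos r)
      rwa [shiftLetter_zero] at this
    have hi : i ∉ N := fun h => lt_irrefl _ (hN i h)
    set F : ℕ → ℝ≥0∞ := fun f => psum s M k (l ++ [f]) with hF
    have hFi : F i ≤ ∑' n, (T : Set ℕ).indicator F n := by
      have h2 := psum_letter_le h0 h1 M k l [] i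
      simp only [List.append_nil] at h2
      refine h2.trans ?_
      rw [← tsum_subtype, Finset.tsum_subtype' T F, hT, Finset.sum_image]
      intro a _ b _ hab
      have := (shiftLetter_strictMono i).injective hab
      omega
    calc psum s (insert i N) (k + 1) l
        ≤ ∑' n, (insert i N).indicator F n := by
          rw [psum_succ]
          exact ENNReal.tsum_le_tsum fun n => Set.indicator_le_indicator (ih _)
      _ = ∑' n, (({i} : Set ℕ).indicator F n + N.indicator F n) := by
          refine tsum_congr fun n => ?_
          rw [Set.insert_eq, Set.indicator_union_of_disjoint (by simpa using hi)]
      _ = F i + ∑' n, N.indicator F n := by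
          rw [ENNReal.tsum_add, ← tsum_subtype {i} F, tsum_singleton i F]
      _ ≤ ∑' n, ((T : Set ℕ).indicator F n + N.indicator F n) := by
          rw [ENNReal.tsum_add]
          gcongr
      _ = ∑' n, ((T : Set ℕ) ∪ N).indicator F n := by
          refine tsum_congr fun n => ?_
          rw [Set.indicator_union_of_disjoint]
          rw [Set.disjoint_left]
          intro a ha haN
          exact lt_asymm (hlt a ha) (hN a haN)
      _ ≤ psum s M (k + 1) l := by
          rw [psum_succ]
          refine ENNReal.tsum_le_tsum fun n =>
            Set.indicator_le_indicator_of_subset ?_ (fun _ => zero_le) n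
          exact Set.union_subset (fun n hn => hM n (hlt n hn)) hNM

/-! ### Adding a letter of small weight -/

lemma inv_sq_le_pow (l : List ℕ) : ((qp (digits l)).1 ^ 2)⁻¹ ≤ (1 / 4) ^ l.length := by
  rw [one_div, inv_pow]
  refine inv_anti₀ (by positivity) ?_
  rw [← sq_abs]
  calc (4 : ℝ) ^ l.length = (2 ^ l.length) ^ 2 := by rw [← pow_mul, mul_comm, pow_mul]; norm_num
    _ ≤ _ := by gcongr; exact two_pow_le_abs_fst l

lemma weight_le_pow_mul {s t : ℝ} (hst : s ≤ t) {n : ℕ} {l : List ℕ} (hl : l.length = n) :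
    weight t l ≤ (ENNReal.ofReal (1 / 4) ^ (t - s)) ^ n * weight s l := by
  have hq := one_le_fst_sq (adm_digits l)
  have hpos : 0 < ENNReal.ofReal (((qp (digits l)).1 ^ 2)⁻¹) := by
    rw [ENNReal.ofReal_pos]; positivity
  unfold weight
  rw [show t = (t - s) + s by ring, ENNReal.rpow_add _ _ hpos.ne' ENNReal.ofReal_ne_top]
  rw [add_sub_cancel_right]
  gcongr
  rw [← ENNReal.rpow_mul_natCast, mul_comm, ENNReal.rpow_natCast_mul]
  refine ENNReal.rpow_le_rpow ?_ (by linarith)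
  rw [← ENNReal.ofReal_pow (by norm_num)]
  refine ENNReal.ofReal_le_ofReal ?_
  rw [← hl]
  exact inv_sq_le_pow l

lemma psum_le_pow_mul {s t : ℝ} (hst : s ≤ t) (N : Set ℕ) (k : ℕ) (l : List ℕ) :
    psum t N k l ≤ (ENNReal.ofReal (1 / 4) ^ (t - s)) ^ (l.length + k) * psum s N k l := by
  induction k generalizing l with
  | zero => exact weight_le_pow_mul hst rfl
  | succ k ih =>
    rw [psum_succ, psum_succ]
    refine tsum_indicator_le_mul fun i => ?_
    have := ih (l ++ [i])
    rw [List.length_append, List.length_singleton] at this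
    rwa [show l.length + (k + 1) = l.length + 1 + k by ring]

lemma tsum_psum_ne_top {s t : ℝ} (hst : s < t) {N : Set ℕ} (h : Good s N) :
    ∑' k, psum t N k [] ≠ ∞ := by
  set η := ENNReal.ofReal (1 / 4) ^ (t - s) with hη
  have hη1 : η < 1 := ENNReal.rpow_lt_one (by rw [ENNReal.ofReal_lt_one]; norm_num) (by linarith)
  have h2 : ∑' k, psum t N k [] ≤ ∑' k, η ^ k * ENNReal.ofReal (9 / 4) := by
    refine ENNReal.tsum_le_tsum fun k => ?_
    have := psum_le_pow_mul hst.le N k []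
    rw [List.length_nil, zero_add] at this
    exact this.trans (by gcongr; exact h k)
  refine ne_top_of_le_ne_top ?_ h2
  rw [ENNReal.tsum_mul_right, ENNReal.tsum_geometric]
  exact ENNReal.mul_ne_top (ENNReal.inv_ne_top.2 (tsub_pos_of_lt hη1).ne') ENNReal.ofReal_ne_top

lemma good_insert_of_weight_le {t : ℝ} (h0 : 0 ≤ t) (h1 : t ≤ 1) {N : Set ℕ}
    (hN : ∑' k, psum t N k [] ≠ ∞) {i : ℕ} (hi : i ∉ N)
    (hw : 16 * weight t [i] * ∑' k, psum t N k [] ≤ 1) : Good t (insert i N) := by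
  set H := ∑' k, psum t N k [] with hH
  have hsuper : ∀ l, ∑' n, (insert i N).indicator (fun n => ∑' k, psum t N k (l ++ [n])) n ≤
      ∑' k, psum t N k l := by
    intro l
    have h2 : ∑' k, psum t N k (l ++ [i]) ≤ weight t l := by
      calc ∑' k, psum t N k (l ++ [i]) ≤ ∑' k, 4 * weight t (l ++ [i]) * psum t N k [] := by
            refine ENNReal.tsum_le_tsum fun k => ?_
            have := psum_append_le h0 h1 N k (l ++ [i]) []
            rwa [List.append_nil] at this
        _ = 4 * weight t (l ++ [i]) * H := ENNReal.tsum_mul_left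
        _ ≤ 4 * (4 * (weight t l * weight t [i])) * H := by
            gcongr; exact weight_append_le h0 h1 _ _
        _ = weight t l * (16 * weight t [i] * H) := by ring
        _ ≤ weight t l * 1 := by gcongr
        _ = weight t l := mul_one _
    calc ∑' n, (insert i N).indicator (fun n => ∑' k, psum t N k (l ++ [n])) n
        = ∑' k, psum t N k (l ++ [i]) +
          ∑' n, N.indicator (fun n => ∑' k, psum t N k (l ++ [n])) n := by
          rw [← tsum_singleton i (fun n => ∑' k, psum t N k (l ++ [n])),
            tsum_subtype {i} (fun n => ∑' k, psum t N k (l ++ [n])), ← ENNReal.tsum_add]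
          refine tsum_congr fun n => ?_
          rw [Set.insert_eq, Set.indicator_union_of_disjoint (by simpa using hi)]
      _ ≤ weight t l + ∑' n, N.indicator (fun n => ∑' k, psum t N k (l ++ [n])) n := by gcongr
      _ = weight t l + ∑' k, psum t N (k + 1) l := by
          congr 1
          simp_rw [psum_succ]
          rw [ENNReal.tsum_comm]
          refine tsum_congr fun n => ?_
          by_cases hn : n ∈ N <;> simp [hn]
      _ = ∑' k, psum t N k l := by
          rw [← psum_zero t N l]
          exact (tsum_eq_zero_add' (f := fun k => psum t N k l) ENNReal.summable).symm
  have hle : ∀ k l, psum t (insert i N) k l ≤ ∑' k, psum t N k l := by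
    intro k
    induction k with
    | zero => exact fun l => ENNReal.le_tsum (f := fun k => psum t N k l) 0
    | succ k ih =>
      intro l
      rw [psum_succ]
      refine le_trans (ENNReal.tsum_le_tsum fun n => ?_) (hsuper l)
      exact Set.indicator_le_indicator (ih _)
  exact good_of_bounded h0 h1 hN fun k => hle k []

lemma finite_weight_gt {t : ℝ} (ht : 0 < t) {c : ℝ≥0∞} (hc : 0 < c) :
    {i | c < weight t [i]}.Finite := by
  have h1 : Tendsto (fun x : ℝ≥0∞ => x ^ t) (𝓝 0) (𝓝 0) := by
    have := (ENNReal.continuous_rpow_const (y := t)).tendsto 0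
    rwa [ENNReal.zero_rpow_of_pos ht] at this
  have h2 : Tendsto (fun x : ℝ => ENNReal.ofReal ((x ^ 2)⁻¹) ^ t) atTop (𝓝 0) := by
    refine h1.comp ?_
    have h3 : Tendsto (fun x : ℝ => (x ^ 2)⁻¹) atTop (𝓝 0) :=
      tendsto_inv_atTop_zero.comp (tendsto_pow_atTop two_ne_zero)
    simpa using ENNReal.tendsto_ofReal h3
  obtain ⟨B, hB⟩ := (h2.eventually (ge_mem_nhds hc)).exists_forall_of_atTop
  refine (finite_abs_fst_le B).subset fun i hi => ?_
  by_contra hlt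
  have := hB _ (le_of_lt (not_le.1 hlt))
  rw [sq_abs] at this
  rw [Set.mem_ofPred_eq, weight, digits_singleton] at hi
  exact absurd this (not_le.2 hi)

/-! ### The coding map -/

lemma abs_comp_digits_sub_le (l : List ℕ) {x y : ℝ} (hx : |x| ≤ 1 / 2) (hy : |y| ≤ 1 / 2) :
    |nicfComp (digits l) x - nicfComp (digits l) y| ≤ 4 * ((qp (digits l)).1 ^ 2)⁻¹ * |x - y| := by
  have h := adm_digits l
  have h1 := h.abs_comp_sub (hx.trans (by norm_num)) (hy.trans (by norm_num))
  have h2 := one_le_fst_sq h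
  have h3 : (qp (digits l)).1 ^ 2 / 4 ≤ |den (digits l) x| * |den (digits l) y| := by
    calc (qp (digits l)).1 ^ 2 / 4 = |(qp (digits l)).1| / 2 * (|(qp (digits l)).1| / 2) := by
          rw [← sq_abs]; ring
      _ ≤ _ := mul_le_mul (h.le_abs_den hx) (h.le_abs_den hy) (by positivity) (abs_nonneg _)
  rw [← h1, mul_assoc, ← div_eq_inv_mul, ← mul_div_assoc, le_div_iff₀ (by linarith)]
  nlinarith [mul_le_mul_of_nonneg_left h3
    (abs_nonneg (nicfComp (digits l) x - nicfComp (digits l) y))]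

lemma le_abs_comp_digits_sub (l : List ℕ) {x y : ℝ} (hx : |x| ≤ 1 / 2) (hy : |y| ≤ 1 / 2) :
    4 / 9 * ((qp (digits l)).1 ^ 2)⁻¹ * |x - y| ≤
      |nicfComp (digits l) x - nicfComp (digits l) y| := by
  have h := adm_digits l
  have h1 := h.abs_comp_sub (hx.trans (by norm_num)) (hy.trans (by norm_num))
  have h2 := one_le_fst_sq h
  have h3 : |den (digits l) x| * |den (digits l) y| ≤ 9 / 4 * (qp (digits l)).1 ^ 2 := by
    calc |den (digits l) x| * |den (digits l) y|
        ≤ (3 / 2 * |(qp (digits l)).1|) * (3 / 2 * |(qp (digits l)).1|) :=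
          mul_le_mul (h.abs_den_le hx) (h.abs_den_le hy) (abs_nonneg _) (by positivity)
      _ = _ := by rw [← sq_abs]; ring
  rw [← h1, mul_assoc, ← div_eq_inv_mul, ← mul_div_assoc, div_le_iff₀ (by linarith)]
  nlinarith [mul_le_mul_of_nonneg_left h3
    (abs_nonneg (nicfComp (digits l) x - nicfComp (digits l) y))]

/-- The first `n` letters of a sequence. -/
def pref (t : ℕ → ℕ) (n : ℕ) : List ℕ := (List.range n).map t

lemma length_pref (t : ℕ → ℕ) (n : ℕ) : (pref t n).length = n := by simp [pref]

lemma pref_succ (t : ℕ → ℕ) (n : ℕ) : pref t (n + 1) = pref t n ++ [t n] := by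
  simp [pref, List.range_succ]

lemma pref_add (t : ℕ → ℕ) (k n : ℕ) :
    pref t (k + n) = pref t k ++ pref (fun j => t (k + j)) n := by
  simp [pref, List.range_add, Function.comp_def]

lemma pref_eq_ofFn (t : ℕ → ℕ) (n : ℕ) : pref t n = List.ofFn fun j : Fin n => t j := by
  induction n with
  | zero => rfl
  | succ n ih => rw [pref_succ, ih, List.ofFn_succ_last]; rfl

/-- The images of zero under the compositions coded by the prefixes of a sequence. -/
noncomputable def approx (t : ℕ → ℕ) (n : ℕ) : ℝ := nicfComp (digits (pref t n)) 0

lemma approx_eq (t : ℕ → ℕ) :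
    approx t = fun n => nicfComp ((List.range n).map fun n => letter (t n)).flatten 0 := by
  funext n
  simp [approx, pref, digits, Function.comp_def]

lemma cauchySeq_approx (t : ℕ → ℕ) : CauchySeq (approx t) := by
  refine cauchySeq_of_le_geometric (1 / 4) 2 (by norm_num) fun n => ?_
  rw [approx, approx, pref_succ, digits_append, digits_singleton, comp_append, Real.dist_eq]
  have h1 := abs_comp_letter_lt (t n) (x := 0) (by norm_num)
  refine (abs_comp_digits_sub_le _ (by norm_num) h1.le).trans ?_
  have h2 := inv_sq_le_pow (pref t n)
  rw [length_pref] at h2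
  rw [zero_sub, abs_neg]
  calc _ ≤ 4 * (1 / 4) ^ n * (1 / 2 : ℝ) := by gcongr
    _ = _ := by ring

/-- The point coded by a sequence of letters. -/
noncomputable def code (t : ℕ → ℕ) : ℝ := limUnder atTop (approx t)

lemma tendsto_code (t : ℕ → ℕ) : Tendsto (approx t) atTop (𝓝 (code t)) :=
  (cauchySeq_approx t).tendsto_limUnder

lemma abs_code_le (t : ℕ → ℕ) : |code t| ≤ 1 / 2 :=
  le_of_tendsto (tendsto_code t).abs (Eventually.of_forall fun _ => abs_comp_digits_zero_le _)

lemma code_eq (t : ℕ → ℕ) (k : ℕ) :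
    code t = nicfComp (digits (pref t k)) (code fun j => t (k + j)) := by
  refine tendsto_nhds_unique ((tendsto_code t).comp (tendsto_add_atTop_nat k)) ?_
  have h1 : ∀ n, approx t (n + k) =
      nicfComp (digits (pref t k)) (approx (fun j => t (k + j)) n) := by
    intro n
    rw [approx, approx, add_comm, pref_add, digits_append, comp_append]
  rw [tendsto_iff_dist_tendsto_zero]
  have h2 := tendsto_iff_dist_tendsto_zero.1 (tendsto_code fun j => t (k + j))
  refine squeeze_zero (fun _ => dist_nonneg) (fun n => ?_)
    (by simpa using h2.const_mul (4 * ((qp (digits (pref t k))).1 ^ 2)⁻¹))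
  rw [Function.comp_apply, h1]
  exact abs_comp_digits_sub_le _ (abs_comp_digits_zero_le _) (abs_code_le _)

lemma mem_limitSet_iff (N : Set ℕ) (x : ℝ) :
    x ∈ nicfLimitSetW (letter '' N) ↔ ∃ t : ℕ → ℕ, (∀ n, t n ∈ N) ∧ code t = x := by
  constructor
  · rintro ⟨τ, hτ, hx⟩
    choose t ht htτ using hτ
    refine ⟨t, ht, tendsto_nhds_unique (tendsto_code t) ?_⟩
    obtain rfl : (fun n => letter (t n)) = τ := funext htτ
    rwa [approx_eq]
  · rintro ⟨t, ht, rfl⟩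
    refine ⟨fun n => letter (t n), fun n => Set.mem_image_of_mem _ (ht n), ?_⟩
    rw [← approx_eq]
    exact tendsto_code t

/-! ### The upper bound for the dimension -/

/-- The list of the letters of a tuple. -/
def tupleList {N : Set ℕ} {k : ℕ} (τ : Fin k → N) : List ℕ := List.ofFn fun j => (τ j : ℕ)

lemma length_tupleList {N : Set ℕ} {k : ℕ} (τ : Fin k → N) : (tupleList τ).length = k := by
  simp [tupleList]

lemma psum_eq_tsum (s : ℝ) (N : Set ℕ) (k : ℕ) (l : List ℕ) :
    psum s N k l = ∑' τ : Fin k → N, weight s (l ++ tupleList τ) := by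
  induction k generalizing l with
  | zero => rw [tsum_fintype, Fintype.sum_unique]; simp [tupleList, psum_zero]
  | succ k ih =>
    rw [psum_succ, ← tsum_subtype N (fun i => psum s N k (l ++ [i])),
      ← (Fin.consEquiv fun _ : Fin (k + 1) => (N : Type)).tsum_eq, ENNReal.tsum_prod']
    refine tsum_congr fun i => ?_
    rw [ih]
    refine tsum_congr fun τ => ?_
    rw [List.append_assoc]
    simp [tupleList, Fin.consEquiv, List.ofFn_succ]

lemma dimH_limitSet_le {s : ℝ} (h0 : 0 ≤ s) {N : Set ℕ} (h : Good s N) :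
    dimH (nicfLimitSetW (letter '' N)) ≤ ENNReal.ofReal s := by
  refine dimH_le_of_hausdorffMeasure_ne_top (d := s.toNNReal) ?_
  rw [Real.coe_toNNReal s h0]
  have hdiam : ∀ l : List ℕ, Metric.ediam (nicfComp (digits l) '' {x | |x| ≤ 1 / 2}) ≤
      ENNReal.ofReal (4 * ((qp (digits l)).1 ^ 2)⁻¹) := by
    intro l
    refine Metric.ediam_le_of_forall_dist_le ?_
    rintro _ ⟨x, hx, rfl⟩ _ ⟨y, hy, rfl⟩
    refine (abs_comp_digits_sub_le l hx hy).trans ?_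
    have h1 : |x - y| ≤ 1 := by
      have := abs_le.1 (show |x| ≤ 1 / 2 from hx)
      have := abs_le.1 (show |y| ≤ 1 / 2 from hy)
      rw [abs_le]; constructor <;> linarith
    exact mul_le_of_le_one_right (by positivity) h1
  have hr : Tendsto (fun k : ℕ => ENNReal.ofReal (4 * (1 / 4) ^ k)) atTop (𝓝 0) := by
    rw [← ENNReal.ofReal_zero]
    refine ENNReal.tendsto_ofReal ?_
    simpa using (tendsto_pow_atTop_nhds_zero_of_lt_one (r := (1 / 4 : ℝ))
      (by norm_num) (by norm_num)).const_mul 4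
  have h2 := MeasureTheory.Measure.hausdorffMeasure_le_liminf_tsum (ι := fun k : ℕ => Fin k → N) s
    (nicfLimitSetW (letter '' N)) _ hr
    (fun k τ => nicfComp (digits (tupleList τ)) '' {x | |x| ≤ 1 / 2})
    (Eventually.of_forall fun k τ => by
      refine (hdiam _).trans (ENNReal.ofReal_le_ofReal ?_)
      have := inv_sq_le_pow (tupleList τ)
      rw [length_tupleList] at this
      gcongr)
    (Eventually.of_forall fun k x hx => by
      obtain ⟨t, ht, rfl⟩ := (mem_limitSet_iff N x).1 hx
      refine Set.mem_iUnion.2 ⟨fun j => ⟨t j, ht j⟩, code fun j => t (k + j), abs_code_le _, ?_⟩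
      rw [code_eq t k, pref_eq_ofFn]
      rfl)
  refine ne_top_of_le_ne_top ?_ h2
  have h3 : ∀ k : ℕ, ∑' τ : Fin k → N,
      Metric.ediam (nicfComp (digits (tupleList τ)) '' {x | |x| ≤ 1 / 2}) ^ s ≤
        ENNReal.ofReal 4 ^ s * ENNReal.ofReal (9 / 4) := by
    intro k
    calc _ ≤ ∑' τ : Fin k → N, ENNReal.ofReal 4 ^ s * weight s (tupleList τ) := by
          refine ENNReal.tsum_le_tsum fun τ => ?_
          rw [weight, ← ENNReal.mul_rpow_of_nonneg _ _ h0, ← ENNReal.ofReal_mul (by norm_num)]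
          exact ENNReal.rpow_le_rpow (hdiam _) h0
      _ = ENNReal.ofReal 4 ^ s * psum s N k [] := by rw [ENNReal.tsum_mul_left, psum_eq_tsum]; rfl
      _ ≤ _ := by gcongr; exact h k
  refine ne_top_of_le_ne_top ?_ (liminf_le_of_frequently_le' (Frequently.of_forall h3))
  exact ENNReal.mul_ne_top (ENNReal.rpow_ne_top_of_nonneg h0 ENNReal.ofReal_ne_top)
    ENNReal.ofReal_ne_top

/-! ### The lower bound for the dimension -/

lemma exists_interval_partition {ι : Type*} (S : Finset ι) (p : ι → ℝ) :
    ∃ a : ι → ℝ, ∀ y, 0 ≤ y → y < ∑ i ∈ S, p i → ∃ i ∈ S, a i ≤ y ∧ y < a i + p i := by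
  classical
  induction S using Finset.induction_on with
  | empty => exact ⟨0, fun y h0 h1 => absurd h1 (by simpa using h0)⟩
  | insert i S hi ih =>
    obtain ⟨a, ha⟩ := ih
    refine ⟨Function.update a i (∑ j ∈ S, p j), fun y h0 h1 => ?_⟩
    rw [Finset.sum_insert hi] at h1
    rcases lt_or_ge y (∑ j ∈ S, p j) with h2 | h2
    · obtain ⟨j, hj, h3⟩ := ha y h0 h2
      refine ⟨j, Finset.mem_insert_of_mem hj, ?_⟩
      rwa [Function.update_of_ne (ne_of_mem_of_not_mem hj hi)]
    · refine ⟨i, Finset.mem_insert_self i S, ?_⟩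
      rw [Function.update_self]
      exact ⟨h2, by linarith⟩

lemma abs_sub_le_of_selfSimilar {ι : Type*} {s ρ δ : ℝ} (hs : 0 < s) (hρ : ρ < 1) (hδ : 0 < δ)
    {a r : ι → ℝ} (hr : ∀ i, 0 < r i) (hrρ : ∀ i, r i ^ s ≤ ρ) {c : ℝ → ι} {T x : ℝ → ℝ}
    (hT : ∀ y ∈ Set.Ico (0 : ℝ) 1, T y ∈ Set.Ico (0 : ℝ) 1)
    (hy : ∀ y ∈ Set.Ico (0 : ℝ) 1, y = a (c y) + r (c y) ^ s * T y)
    (heq : ∀ y y', c y = c y' → r (c y) * |x (T y) - x (T y')| ≤ |x y - x y'|)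
    (hne : ∀ y y', c y ≠ c y' → δ ≤ |x y - x y'|) :
    ∀ y ∈ Set.Ico (0 : ℝ) 1, ∀ y' ∈ Set.Ico (0 : ℝ) 1,
      |y - y'| ≤ (δ⁻¹) ^ s * |x y - x y'| ^ s := by
  have hle : ∀ y ∈ Set.Ico (0 : ℝ) 1, ∀ y' ∈ Set.Ico (0 : ℝ) 1, |y - y'| ≤ 1 := by
    rintro y ⟨h1, h2⟩ y' ⟨h3, h4⟩
    rw [abs_le]
    constructor <;> linarith
  have key : ∀ n : ℕ, ∀ y ∈ Set.Ico (0 : ℝ) 1, ∀ y' ∈ Set.Ico (0 : ℝ) 1,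
      |y - y'| ≤ (δ⁻¹) ^ s * |x y - x y'| ^ s + ρ ^ n := by
    intro n
    induction n with
    | zero =>
      intro y h y' h'
      rw [pow_zero]
      have := hle y h y' h'
      have : 0 ≤ (δ⁻¹) ^ s * |x y - x y'| ^ s := by positivity
      linarith
    | succ n ih =>
      intro y h y' h'
      have hρ0 : 0 ≤ ρ := le_trans (Real.rpow_nonneg (hr (c y)).le s) (hrρ (c y))
      by_cases hc : c y = c y'
      · have h1 : y - y' = r (c y) ^ s * (T y - T y') := by
          have e1 := hy y h
          have e2 := hy y' h'
          rw [← hc] at e2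
          linear_combination e1 - e2
        have hp : 0 ≤ r (c y) ^ s := Real.rpow_nonneg (hr _).le s
        rw [h1, abs_mul, abs_of_nonneg hp]
        calc r (c y) ^ s * |T y - T y'|
            ≤ r (c y) ^ s * ((δ⁻¹) ^ s * |x (T y) - x (T y')| ^ s + ρ ^ n) := by
              gcongr
              exact ih _ (hT y h) _ (hT y' h')
          _ = (δ⁻¹) ^ s * (r (c y) * |x (T y) - x (T y')|) ^ s + r (c y) ^ s * ρ ^ n := by
              rw [Real.mul_rpow (hr _).le (abs_nonneg _)]
              ring
          _ ≤ (δ⁻¹) ^ s * |x y - x y'| ^ s + ρ * ρ ^ n := by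
              gcongr
              · exact mul_nonneg (hr _).le (abs_nonneg _)
              · exact heq y y' hc
              · exact hrρ _
          _ = _ := by rw [pow_succ']
      · have h1 : 1 ≤ (δ⁻¹) ^ s * |x y - x y'| ^ s := by
          rw [← Real.mul_rpow (by positivity) (abs_nonneg _)]
          refine Real.one_le_rpow ?_ hs.le
          rw [← div_eq_inv_mul, one_le_div hδ]
          exact hne y y' hc
        have := hle y h y' h'
        have : 0 ≤ ρ ^ (n + 1) := pow_nonneg hρ0 _
        linarith
  intro y h y' h'
  have hρ0 : 0 ≤ ρ := le_trans (Real.rpow_nonneg (hr (c y)).le s) (hrρ (c y))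
  have h1 : Tendsto (fun n : ℕ => (δ⁻¹) ^ s * |x y - x y'| ^ s + ρ ^ n) atTop
      (𝓝 ((δ⁻¹) ^ s * |x y - x y'| ^ s + 0)) :=
    tendsto_const_nhds.add (tendsto_pow_atTop_nhds_zero_of_lt_one hρ0 hρ)
  rw [add_zero] at h1
  exact ge_of_tendsto' h1 fun n => key n y h y' h'

lemma le_dimH_of_abs_sub_le {s C : ℝ} (hs : 0 < s) (hC : 0 ≤ C) {x : ℝ → ℝ} {J : Set ℝ}
    (hJ : ∀ y ∈ Set.Ico (0 : ℝ) 1, x y ∈ J)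
    (h : ∀ y ∈ Set.Ico (0 : ℝ) 1, ∀ y' ∈ Set.Ico (0 : ℝ) 1, |y - y'| ≤ C * |x y - x y'| ^ s) :
    ENNReal.ofReal s ≤ dimH J := by
  set I := Set.Ico (0 : ℝ) 1 with hI
  have hinj : Set.InjOn x I := by
    intro y hy y' hy' hxy
    have := h y hy y' hy'
    rw [hxy, sub_self, abs_zero, Real.zero_rpow hs.ne', mul_zero] at this
    exact sub_eq_zero.1 (abs_nonpos_iff.1 this)
  have hinv := hinj.leftInvOn_invFunOn
  have hH : HolderOnWith C.toNNReal s.toNNReal (Function.invFunOn x I) (x '' I) := by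
    rintro _ ⟨y, hy, rfl⟩ _ ⟨y', hy', rfl⟩
    rw [hinv hy, hinv hy', edist_dist, edist_dist, Real.coe_toNNReal s hs.le,
      ENNReal.ofReal_rpow_of_nonneg dist_nonneg hs.le]
    change _ ≤ ENNReal.ofReal C * _
    rw [← ENNReal.ofReal_mul hC]
    exact ENNReal.ofReal_le_ofReal (h y hy y' hy')
  have h1 := hH.dimH_image_le (Real.toNNReal_pos.2 hs)
  rw [hinv.image_image] at h1
  have h2 : dimH I = 1 := by
    rw [Real.dimH_of_nonempty_interior]
    · simp
    · rw [hI, interior_Ico]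
      exact Set.nonempty_Ioo.2 one_pos
  rw [h2, ENNReal.le_div_iff_mul_le (Or.inl (by simpa using hs)) (Or.inl ENNReal.coe_ne_top),
    one_mul] at h1
  exact h1.trans (dimH_mono (Set.image_subset_iff.2 hJ))

lemma continuousOn_comp_digits (l : List ℕ) :
    ContinuousOn (nicfComp (digits l)) {x | |x| ≤ 1 / 2} := by
  have : LipschitzOnWith (4 * ((qp (digits l)).1 ^ 2)⁻¹).toNNReal (nicfComp (digits l))
      {x | |x| ≤ 1 / 2} := by
    refine LipschitzOnWith.of_dist_le_mul fun x hx y hy => ?_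
    rw [Real.coe_toNNReal _ (by positivity)]
    exact abs_comp_digits_sub_le l hx hy
  exact this.continuousOn

lemma isCompact_abs_le (c : ℝ) : IsCompact {x : ℝ | |x| ≤ c} := by
  have : {x : ℝ | |x| ≤ c} = Set.Icc (-c) c := by ext x; exact abs_le (a := x)
  rw [this]
  exact isCompact_Icc

lemma exists_separation {N : Set ℕ} (hN : N.Finite) (k : ℕ) :
    ∃ δ > 0, ∀ t t' : ℕ → ℕ, (∀ n, t n ∈ N) → (∀ n, t' n ∈ N) → pref t k ≠ pref t' k →
      δ ≤ |code t - code t'| := by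
  have := hN.to_subtype
  set K : Set ℝ := ⋃ i ∈ N, nicfComp (letter i) '' {x | |x| ≤ 1 / 2} with hK
  have hKc : IsCompact K := by
    refine hN.isCompact_biUnion fun i _ => (isCompact_abs_le _).image_of_continuousOn ?_
    rw [← digits_singleton]
    exact continuousOn_comp_digits [i]
  have hKlt : ∀ x ∈ K, |x| < 1 / 2 := by
    intro x hx
    obtain ⟨i, -, y, hy, rfl⟩ := Set.mem_iUnion₂.1 hx
    exact abs_comp_letter_lt i hy
  have hcode : ∀ t : ℕ → ℕ, (∀ n, t n ∈ N) → code t ∈ K := by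
    intro t ht
    refine Set.mem_iUnion₂.2 ⟨t 0, ht 0, _, abs_code_le fun j => t (1 + j), ?_⟩
    rw [code_eq t 1, ← digits_singleton]
    rfl
  have hsep : ∀ p : (Fin k → N) × (Fin k → N), ∃ δ > 0, tupleList p.1 ≠ tupleList p.2 →
      ∀ x ∈ K, ∀ y ∈ K, δ ≤ |nicfComp (digits (tupleList p.1)) x -
        nicfComp (digits (tupleList p.2)) y| := by
    rintro ⟨τ, τ'⟩
    by_cases hne : tupleList τ = tupleList τ'
    · exact ⟨1, one_pos, fun h => absurd hne h⟩
    have hc : ∀ l : List ℕ, IsCompact (nicfComp (digits l) '' K) := fun l =>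
      hKc.image_of_continuousOn ((continuousOn_comp_digits l).mono fun x hx => (hKlt x hx).le)
    have hdisj : Disjoint (nicfComp (digits (tupleList τ)) '' K)
        (nicfComp (digits (tupleList τ')) '' K) := by
      rw [Set.disjoint_left]
      rintro _ ⟨x, hx, rfl⟩ ⟨y, hy, hxy⟩
      exact hne (comp_digits_inj (by rw [length_tupleList, length_tupleList]) (hKlt x hx)
        (hKlt y hy) hxy.symm)
    obtain ⟨δ, hδ, hd⟩ := hdisj.exists_thickenings (hc _) (hc _).isClosed
    refine ⟨δ, hδ, fun _ x hx y hy => ?_⟩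
    by_contra hlt
    refine Set.disjoint_left.1 hd
      (Metric.mem_thickening_iff.2 ⟨_, Set.mem_image_of_mem _ hx, ?_⟩)
      (Metric.self_subset_thickening hδ _ (Set.mem_image_of_mem _ hy))
    rw [dist_comm]
    exact not_le.1 hlt
  choose δ hδ hδsep using hsep
  obtain ⟨ε, hε, hεδ⟩ : ∃ ε > 0, ∀ p, ε ≤ δ p := by
    have h1 : ∀ᶠ ε in 𝓝[>] (0 : ℝ), ∀ p, ε ≤ δ p :=
      eventually_all.2 fun p => nhdsWithin_le_nhds (ge_mem_nhds (hδ p))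
    obtain ⟨ε, h2, h3⟩ := (h1.and self_mem_nhdsWithin).exists
    exact ⟨ε, h3, h2⟩
  refine ⟨ε, hε, fun t t' ht ht' hne => ?_⟩
  have h1 := hδsep (fun j => ⟨t j, ht j⟩, fun j => ⟨t' j, ht' j⟩)
  rw [code_eq t k, code_eq t' k]
  rw [pref_eq_ofFn, pref_eq_ofFn] at hne ⊢
  exact (hεδ _).trans
    (h1 hne _ (hcode _ fun n => ht (k + n)) _ (hcode _ fun n => ht' (k + n)))

lemma exists_finite_of_not_good {s : ℝ} {N : Set ℕ} (h : ¬ Good s N) :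
    ∃ M ⊆ N, M.Finite ∧ ¬ Good s M := by
  by_contra hcon
  push Not at hcon
  refine h ?_
  have hN : N = ⋃ n, N ∩ Set.Iio n := by
    ext i
    simp only [Set.mem_iUnion, Set.mem_inter_iff, Set.mem_Iio]
    exact ⟨fun hi => ⟨i + 1, hi, i.lt_succ_self⟩, fun ⟨_, hi, _⟩ => hi⟩
  rw [hN]
  exact Good.iUnion (fun n m hnm i hi => ⟨hi.1, hi.2.trans_le hnm⟩) fun n =>
    hcon _ Set.inter_subset_left ((Set.finite_Iio n).inter_of_right N)

/-- The sequence obtained by concatenating the tuples chosen along the orbit of `y` under `T`. -/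
def orbitSeq {N : Set ℕ} {k : ℕ} (hk : 0 < k) (c : ℝ → Fin k → N) (T : ℝ → ℝ) (y : ℝ) (n : ℕ) : ℕ :=
  c (T^[n / k] y) ⟨n % k, Nat.mod_lt n hk⟩

lemma orbitSeq_mem {N : Set ℕ} {k : ℕ} (hk : 0 < k) (c : ℝ → Fin k → N) (T : ℝ → ℝ) (y : ℝ)
    (n : ℕ) : orbitSeq hk c T y n ∈ N := Subtype.coe_prop _

lemma pref_orbitSeq {N : Set ℕ} {k : ℕ} (hk : 0 < k) (c : ℝ → Fin k → N) (T : ℝ → ℝ) (y : ℝ) :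
    pref (orbitSeq hk c T y) k = tupleList (c y) := by
  rw [pref_eq_ofFn, tupleList]
  congr 1
  funext j
  simp [orbitSeq, Nat.div_eq_of_lt j.2, Nat.mod_eq_of_lt j.2]

lemma orbitSeq_add {N : Set ℕ} {k : ℕ} (hk : 0 < k) (c : ℝ → Fin k → N) (T : ℝ → ℝ) (y : ℝ) :
    (fun j => orbitSeq hk c T y (k + j)) = orbitSeq hk c T (T y) := by
  funext j
  simp only [orbitSeq, Nat.add_div_left j hk, Nat.add_mod_left, Function.iterate_succ_apply]

lemma tupleList_injective {N : Set ℕ} {k : ℕ} :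
    Function.Injective (tupleList : (Fin k → N) → List ℕ) := by
  intro τ τ' h
  funext j
  exact Subtype.ext (congrFun (List.ofFn_injective h) j)

lemma le_dimH_limitSet {s : ℝ} (h0 : 0 < s) (h1 : s ≤ 1) {N : Set ℕ} (h : ¬ Good s N) :
    ENNReal.ofReal s ≤ dimH (nicfLimitSetW (letter '' N)) := by
  obtain ⟨M, hMN, hM, hbad⟩ := exists_finite_of_not_good h
  have := hM.to_subtype
  have := Fintype.ofFinite M
  obtain ⟨k, hk⟩ : ∃ k, ENNReal.ofReal (9 / 4) < psum s M k [] := by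
    simpa [Good] using hbad
  have hk0 : 0 < k := by
    rcases Nat.eq_zero_or_pos k with rfl | hk0
    · rw [psum_zero, weight_nil, ENNReal.ofReal_lt_one] at hk
      norm_num at hk
    · exact hk0
  set r : (Fin k → M) → ℝ := fun τ => 4 / 9 * ((qp (digits (tupleList τ))).1 ^ 2)⁻¹ with hr
  have hqpos : ∀ τ : Fin k → M, 0 < ((qp (digits (tupleList τ))).1 ^ 2)⁻¹ := fun τ =>
    inv_pos.2 (zero_lt_one.trans_le (one_le_fst_sq (adm_digits _)))
  have hrpos : ∀ τ, 0 < r τ := fun τ => mul_pos (by norm_num) (hqpos τ)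
  have hrle : ∀ τ, r τ ≤ 4 / 9 := fun τ =>
    mul_le_of_le_one_right (by norm_num) (inv_le_one_of_one_le₀ (one_le_fst_sq (adm_digits _)))
  have hsum : 1 ≤ ∑ τ, r τ ^ s := by
    rw [← ENNReal.one_le_ofReal,
      ENNReal.ofReal_sum_of_nonneg fun τ _ => (by have := hrpos τ; positivity)]
    have h2 : ∀ τ : Fin k → M, ENNReal.ofReal (4 / 9) * weight s (tupleList τ) ≤
        ENNReal.ofReal (r τ ^ s) := by
      intro τ
      rw [weight, ENNReal.ofReal_rpow_of_pos (hqpos τ), ← ENNReal.ofReal_mul (by norm_num)]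
      refine ENNReal.ofReal_le_ofReal ?_
      rw [hr, Real.mul_rpow (by norm_num) (hqpos τ).le]
      have h3 : (4 / 9 : ℝ) ≤ (4 / 9) ^ s :=
        Real.self_le_rpow_of_le_one (by norm_num) (by norm_num) h1
      have := Real.rpow_nonneg (hqpos τ).le s
      gcongr
    calc (1 : ℝ≥0∞) = ENNReal.ofReal (4 / 9) * ENNReal.ofReal (9 / 4) := by
          rw [← ENNReal.ofReal_mul (by norm_num)]; norm_num
      _ ≤ ENNReal.ofReal (4 / 9) * psum s M k [] := by gcongr
      _ = ∑ τ : Fin k → M, ENNReal.ofReal (4 / 9) * weight s (tupleList τ) := by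
          rw [psum_eq_tsum, tsum_fintype, Finset.mul_sum]; rfl
      _ ≤ _ := Finset.sum_le_sum fun τ _ => h2 τ
  obtain ⟨a, ha⟩ := exists_interval_partition Finset.univ fun τ => r τ ^ s
  have hne : Nonempty (Fin k → M) := by
    by_contra hempty
    rw [not_nonempty_iff] at hempty
    rw [Finset.univ_eq_empty, Finset.sum_empty] at hsum
    linarith
  have hc : ∀ y, ∃ τ : Fin k → M, y ∈ Set.Ico (0 : ℝ) 1 → a τ ≤ y ∧ y < a τ + r τ ^ s := by
    intro y
    by_cases hy : y ∈ Set.Ico (0 : ℝ) 1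
    · obtain ⟨τ, -, hτ⟩ := ha y hy.1 (hy.2.trans_le hsum)
      exact ⟨τ, fun _ => hτ⟩
    · exact ⟨Classical.choice hne, fun h => absurd h hy⟩
  choose c hc using hc
  set T : ℝ → ℝ := fun y => (y - a (c y)) / r (c y) ^ s with hT
  obtain ⟨δ, hδ, hsep⟩ := exists_separation hM k
  have hppos : ∀ τ, 0 < r τ ^ s := fun τ => Real.rpow_pos_of_pos (hrpos τ) s
  refine le_dimH_of_abs_sub_le (x := fun y => code (orbitSeq hk0 c T y)) h0
    (Real.rpow_nonneg (inv_nonneg.2 hδ.le) s) (fun y _ => ?_)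
    (abs_sub_le_of_selfSimilar (ρ := (4 / 9) ^ s) (δ := δ) (a := a) (r := r) (c := c) (T := T) h0
      (Real.rpow_lt_one (by norm_num) (by norm_num) h0) hδ hrpos
      (fun τ => Real.rpow_le_rpow (hrpos τ).le (hrle τ) h0.le) ?_ ?_ ?_ ?_)
  · exact (mem_limitSet_iff N _).2 ⟨_, fun n => hMN (orbitSeq_mem hk0 c T y n), rfl⟩
  · intro y hy
    obtain ⟨h2, h3⟩ := hc y hy
    exact ⟨div_nonneg (sub_nonneg.2 h2) (hppos _).le, (div_lt_one (hppos _)).2 (by linarith)⟩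
  · intro y hy
    rw [hT, mul_div_cancel₀ _ (hppos _).ne', add_sub_cancel]
  · intro y y' hcy
    rw [code_eq (orbitSeq hk0 c T y) k, code_eq (orbitSeq hk0 c T y') k, pref_orbitSeq,
      pref_orbitSeq, orbitSeq_add, orbitSeq_add, ← hcy]
    exact le_abs_comp_digits_sub _ (abs_code_le _) (abs_code_le _)
  · intro y y' hcy
    refine hsep _ _ (orbitSeq_mem hk0 c T y) (orbitSeq_mem hk0 c T y') ?_
    rw [pref_orbitSeq, pref_orbitSeq]
    exact fun h => hcy (tupleList_injective h)

/-! ### Realizing every dimension -/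

/-- The letters below `n` kept by the greedy algorithm for the parameter `t`. -/
noncomputable def greedy (t : ℝ) : ℕ → Set ℕ
  | 0 => ∅
  | n + 1 => by
    classical exact if Good t (insert n (greedy t n)) then insert n (greedy t n) else greedy t n

lemma greedy_succ_of_good {t : ℝ} {n : ℕ} (h : Good t (insert n (greedy t n))) :
    greedy t (n + 1) = insert n (greedy t n) := by
  rw [greedy, if_pos h]

lemma greedy_succ_of_not_good {t : ℝ} {n : ℕ} (h : ¬ Good t (insert n (greedy t n))) :
    greedy t (n + 1) = greedy t n := by
  rw [greedy, if_neg h]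

lemma good_greedy (t : ℝ) (n : ℕ) : Good t (greedy t n) := by
  induction n with
  | zero => exact good_empty t
  | succ n ih =>
    by_cases h : Good t (insert n (greedy t n))
    · rwa [greedy_succ_of_good h]
    · rwa [greedy_succ_of_not_good h]

lemma greedy_monotone (t : ℝ) : Monotone (greedy t) := by
  refine monotone_nat_of_le_succ fun n => ?_
  by_cases h : Good t (insert n (greedy t n))
  · rw [greedy_succ_of_good h]
    exact Set.subset_insert _ _
  · rw [greedy_succ_of_not_good h]

lemma lt_of_mem_greedy {t : ℝ} {n i : ℕ} (hi : i ∈ greedy t n) : i < n := by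
  induction n with
  | zero => exact hi.elim
  | succ n ih =>
    by_cases h : Good t (insert n (greedy t n))
    · rw [greedy_succ_of_good h] at hi
      rcases hi with rfl | hi
      · exact i.lt_succ_self
      · exact (ih hi).trans n.lt_succ_self
    · rw [greedy_succ_of_not_good h] at hi
      exact (ih hi).trans n.lt_succ_self

lemma not_good_insert_greedy {t : ℝ} {i : ℕ} (hi : i ∉ ⋃ n, greedy t n) :
    ¬ Good t (insert i (greedy t i)) := by
  intro h
  refine hi (Set.mem_iUnion.2 ⟨i + 1, ?_⟩)
  rw [greedy_succ_of_good h]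
  exact Set.mem_insert _ _

lemma iUnion_greedy_eq_univ {s t : ℝ} (h0 : 0 ≤ s) (hst : s < t) (h1 : t ≤ 1)
    (h : Good s (⋃ n, greedy t n)) : ⋃ n, greedy t n = Set.univ := by
  set N := ⋃ n, greedy t n with hN
  have ht : 0 ≤ t := h0.trans hst.le
  have hgood : Good t N := Good.iUnion (greedy_monotone t) (good_greedy t)
  have hH := tsum_psum_ne_top hst h
  set H := ∑' k, psum t N k [] with hHdef
  have hfin : {i | i ∉ N}.Finite := by
    refine (finite_weight_gt (h0.trans_lt hst)
      (c := (16 * H)⁻¹) (ENNReal.inv_pos.2 (ENNReal.mul_ne_top (by norm_num) hH))).subset ?_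
    intro i hi
    by_contra hle
    refine not_good_insert_greedy hi ?_
    have hw : 16 * weight t [i] * H ≤ 1 := by
      calc 16 * weight t [i] * H = weight t [i] * (16 * H) := by ring
        _ ≤ (16 * H)⁻¹ * (16 * H) := by gcongr; exact not_lt.1 hle
        _ ≤ 1 := ENNReal.inv_mul_le_one _
    exact (good_insert_of_weight_le ht h1 hH hi hw).mono
      (Set.insert_subset_insert (Set.subset_iUnion _ i))
  rw [Set.eq_univ_iff_forall]
  by_contra! hcon
  obtain ⟨i, hi, hmax⟩ := hfin.exists_maximal hcon
  refine not_good_insert_greedy hi fun k => ?_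
  refine (psum_insert_le ht h1 (fun n hn => lt_of_mem_greedy hn) (Set.subset_iUnion _ i)
    (fun n hn => ?_) k []).trans (hgood k)
  by_contra hnN
  exact absurd (hmax hnN hn.le) (not_le.2 hn)

lemma nicfLimitSetW_mono {G H : Set (List ℤ)} (h : G ⊆ H) : nicfLimitSetW G ⊆ nicfLimitSetW H :=
  fun _ ⟨τ, hτ, hx⟩ => ⟨τ, fun n => h (hτ n), hx⟩

lemma dimH_iUnion_greedy {t : ℝ} (h0 : 0 ≤ t) (h1 : t ≤ 1)
    (ht : ENNReal.ofReal t ≤ dimH (nicfLimitSetW nicfEv)) :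
    dimH (nicfLimitSetW (letter '' ⋃ n, greedy t n)) = ENNReal.ofReal t := by
  refine le_antisymm
    (dimH_limitSet_le h0 (Good.iUnion (greedy_monotone t) (good_greedy t))) (le_of_not_gt ?_)
  intro hlt
  obtain ⟨s, hs1, hs2⟩ := ENNReal.lt_iff_exists_nnreal_btwn.1 hlt
  have hs0 : 0 < (s : ℝ) := by exact_mod_cast zero_le.trans_lt hs1
  have hst : (s : ℝ) < t := by
    rw [← ENNReal.ofReal_coe_nnreal] at hs2
    exact (ENNReal.ofReal_lt_ofReal_iff_of_nonneg s.coe_nonneg).1 hs2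
  rw [← ENNReal.ofReal_coe_nnreal] at hs1
  have hgood : Good s (⋃ n, greedy t n) := by
    by_contra hbad
    exact absurd (le_dimH_limitSet hs0 (hst.le.trans h1) hbad) (not_le.2 hs1)
  rw [iUnion_greedy_eq_univ hs0.le hst h1 hgood, Set.image_univ, range_letter] at hlt
  exact absurd ht (not_le.2 hlt)

end NICF

/-- Theorem 1.2: the iterated function system Φ^(v) associated to the NICF via the vertex v
has full Hausdorff dimension spectrum: {dim_H(J_G) : G ⊆ Ē^(v)} = [0, dim_H(J_{Ē^(v)})]. -/
theorem nicf_vertex_full_dimension_spectrum :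
    {d : ℝ≥0∞ | ∃ G : Set (List ℤ), G ⊆ nicfEv ∧ dimH (nicfLimitSetW G) = d}
      = Set.Icc 0 (dimH (nicfLimitSetW nicfEv)) := by
  ext d
  constructor
  · rintro ⟨G, hG, rfl⟩
    exact ⟨zero_le, dimH_mono (NICF.nicfLimitSetW_mono hG)⟩
  · rintro ⟨-, hd⟩
    have h1 : d ≤ 1 := hd.trans ((dimH_mono (Set.subset_univ _)).trans_eq Real.dimH_univ)
    have hd' : ENNReal.ofReal d.toReal = d :=
      ENNReal.ofReal_toReal (ne_top_of_le_ne_top ENNReal.one_ne_top h1)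
    refine ⟨NICF.letter '' ⋃ n, NICF.greedy d.toReal n, ?_, ?_⟩
    · rw [← NICF.range_letter]
      exact Set.image_subset_range _ _
    · rw [NICF.dimH_iUnion_greedy ENNReal.toReal_nonneg
        (ENNReal.toReal_le_of_le_ofReal zero_le_one (by simpa using h1)) (by rwa [hd']), hd']
end

section
/- Let ω_1, …, ω_n be an NICF-admissible sequence satisfying |q_{m−1}| ≤ |q_m| for all 1 ≤ m ≤ n, and suppose that for some k ≥ 1 with n − k − 1 ≥ 1 one has ω_{n−k} = ω_{n−k+1} = ⋯ = ω_{n−1} = 2, |ω_{n−k−1}| ≥ 3 and |ω_n| ≥ 3. Then (2k + 5)·|q_{n−1}| ≤ (k + 2)·|q_n|. -/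
/-- If `c = 2 * b + a` with `|a| ≤ |b|`, then `c` and `b` do not have opposite signs. -/
theorem mul_nonneg_of_abs_le_of_two_mul_add {a b c : ℤ} (h : |a| ≤ |b|) (hc : c = 2 * b + a) :
    0 ≤ c * b := by
  rcases le_total 0 b with hb | hb
  · rw [abs_of_nonneg hb, abs_le] at h
    exact mul_nonneg (by linarith) hb
  · rw [abs_of_nonpos hb, abs_le] at h
    exact mul_nonneg_of_nonpos_of_nonpos (by linarith) hb

/-- If `b` and `a` do not have opposite signs and `3 ≤ w`, then `3 * |b| ≤ |w * b + a|`. -/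
theorem three_mul_abs_le_of_mul_nonneg {a b w : ℤ} (hw : 3 ≤ w) (h : 0 ≤ b * a) :
    3 * |b| ≤ |w * b + a| := by
  have hwb : 0 ≤ (w * b) * a := by
    rw [mul_assoc]
    exact mul_nonneg (by linarith) h
  rw [abs_add_eq_add_abs_iff (w * b) a |>.2 (mul_nonneg_iff.1 hwb), abs_mul,
    abs_of_nonneg (by linarith : 0 ≤ w)]
  nlinarith [abs_nonneg a, abs_nonneg b]

/-- Lemma 5.2: if ω_1, …, ω_n is NICF-admissible, |q_{m−1}| ≤ |q_m| for 1 ≤ m ≤ n,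
and for some k ≥ 1 with n − k − 1 ≥ 1 the digits satisfy ω_{n−k} = ⋯ = ω_{n−1} = 2,
|ω_{n−k−1}| ≥ 3 and |ω_n| ≥ 3, then (2k+5)·|q_{n−1}| ≤ (k+2)·|q_n|. -/
theorem nicf_run_of_twos_ratio (n k : ℕ) (ω q : ℕ → ℤ)
    (hk : 1 ≤ k) (hn : k + 2 ≤ n)
    (hω2 : ∀ m, 1 ≤ m → m ≤ n → 2 ≤ |ω m|)
    (hadm : ∀ m, 1 ≤ m → m < n →
      (ω m = 2 → 0 < ω (m + 1)) ∧ (ω m = -2 → ω (m + 1) < 0))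
    (hq0 : q 0 = 1) (hq1 : q 1 = ω 1)
    (hrec : ∀ m, 2 ≤ m → m ≤ n → q m = ω m * q (m - 1) + q (m - 2))
    (hmono : ∀ m, 1 ≤ m → m ≤ n → |q (m - 1)| ≤ |q m|)
    (h2s : ∀ m, n - k ≤ m → m ≤ n - 1 → ω m = 2)
    (hprev : 3 ≤ |ω (n - k - 1)|) (hlast : 3 ≤ |ω n|) :
    (2 * (k : ℤ) + 5) * |q (n - 1)| ≤ ((k : ℤ) + 2) * |q n| := by
  obtain ⟨m, rfl⟩ : ∃ m, n = m + 3 := ⟨n - 3, by omega⟩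
  have h2 : ω (m + 2) = 2 := h2s (m + 2) (by omega) (by omega)
  have hpos : 0 < ω (m + 3) := (hadm (m + 2) (by omega) (by omega)).1 h2
  rw [abs_of_pos hpos] at hlast
  have hr₂ : q (m + 2) = 2 * q (m + 1) + q m := by
    have h := hrec (m + 2) (by omega) (by omega)
    rwa [h2] at h
  have hr₃ : q (m + 3) = ω (m + 3) * q (m + 2) + q (m + 1) :=
    hrec (m + 3) (by omega) le_rfl
  have hle : |q m| ≤ |q (m + 1)| := hmono (m + 1) (by omega) (by omega)
  have hsign : 0 ≤ q (m + 2) * q (m + 1) :=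
    mul_nonneg_of_abs_le_of_two_mul_add hle hr₂
  have hthree : 3 * |q (m + 2)| ≤ |q (m + 3)| := by
    rw [hr₃]
    exact three_mul_abs_le_of_mul_nonneg hlast hsign
  change (2 * (k : ℤ) + 5) * |q (m + 2)| ≤ ((k : ℤ) + 2) * |q (m + 3)|
  have hk0 : (0 : ℤ) ≤ k := Int.natCast_nonneg k
  nlinarith [abs_nonneg (q (m + 2)), mul_le_mul_of_nonneg_left hthree (by linarith : 0 ≤ (k : ℤ) + 2),
    mul_nonneg hk0 (abs_nonneg (q (m + 2)))]
end
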